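/- Let k be an algebraically closed field of characteristic 0, F = k(x₁,…,xₙ), and Z²(𝔸ⁿ) the free abelian group on the height-two primes of k[x₁,…,xₙ]. Then the sequence 0 → K₂ᴹ(k) → K₂ᴹ(F) →(Tame) ⊕_p κ(p)* →(div) Z²(𝔸ⁿ) → 0 is exact, where the first map is induced by the inclusion k ⊆ F (sending {a,b} to {a,b}), Tame is the total tame symbol, and div is the divisor map. -/

import Mathlib

open scoped TensorProduct

/-- Pre-K₂: the tensor square (over ℤ) of the unit group `F*`, written additively. -/
abbrev K2Pre (F : Type) [Field F] : Type :=
  (Additive Fˣ) ⊗[ℤ] (Additive Fˣ)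

/-- The subgroup of Steinberg relations, generated by the elements `f ⊗ (1 - f)`
for `f ∈ F*`, `f ≠ 1`. -/
noncomputable def steinberg (F : Type) [Field F] : Submodule ℤ (K2Pre F) :=
  Submodule.span ℤ {t | ∃ (f : Fˣ) (h : (1 : F) - (f : F) ≠ 0),
    t = Additive.ofMul f ⊗ₜ[ℤ] Additive.ofMul (Units.mk0 ((1 : F) - (f : F)) h)}

/-- The second Milnor K-group `K₂ᴹ(F)`. -/
noncomputable abbrev MilnorK2 (F : Type) [Field F] : Type :=
  K2Pre F ⧸ steinberg F

/-- The symbol `{f, g} ∈ K₂ᴹ(F)`. -/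
noncomputable def MilnorK2.symbol {F : Type} [Field F] (f g : Fˣ) : MilnorK2 F :=
  Submodule.Quotient.mk (Additive.ofMul f ⊗ₜ[ℤ] Additive.ofMul g)

/-- The subgroup of `K₂ᴹ(F)` generated by the symbols `{f, c}` with `f ∈ F*`, `c ∈ k*`. -/
noncomputable def constSymbols (k F : Type) [Field k] [Field F] [Algebra k F] :
    AddSubgroup (MilnorK2 F) :=
  AddSubgroup.closure {ξ | ∃ (f : Fˣ) (c : kˣ),
    ξ = MilnorK2.symbol f (Units.map (algebraMap k F).toMonoidHom c)}

/-- `K₂(F)/Const`. -/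
noncomputable abbrev K2ModConst (k F : Type) [Field k] [Field F] [Algebra k F] : Type :=
  MilnorK2 F ⧸ constSymbols k F

/-- The class of the symbol `{f, g}` in `K₂(F)/Const`, as a total function on `F`
(junk value `0` if `f` or `g` vanishes). -/
noncomputable def K2ModConst.symb (k : Type) {F : Type} [Field k] [Field F] [Algebra k F]
    (f g : F) : K2ModConst k F :=
  letI := Classical.propDecidable (f ≠ 0 ∧ g ≠ 0)
  if h : f ≠ 0 ∧ g ≠ 0 then
    QuotientAddGroup.mk (MilnorK2.symbol (Units.mk0 f h.1) (Units.mk0 g h.2))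
  else 0

/-- The height-one points of `Spec R` (i.e. height-one primes of `R`). -/
def H1 (R : Type) [CommRing R] : Type := {p : PrimeSpectrum R // Order.height p = 1}

/-- The height-two points of `Spec R` (i.e. height-two primes of `R`). -/
def H2 (R : Type) [CommRing R] : Type := {q : PrimeSpectrum R // Order.height q = 2}

/-- The residue field `κ(p) = Frac(R/p)` of a prime `p`. -/
noncomputable abbrev kappa {R : Type} [CommRing R] (p : PrimeSpectrum R) : Type :=
  FractionRing (R ⧸ p.asIdeal)

/-- The residue class in `κ(p)` of an element of `R`. -/
noncomputable def resid {R : Type} [CommRing R] (p : PrimeSpectrum R) (r : R) : kappa p :=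
  algebraMap (R ⧸ p.asIdeal) (kappa p) (Ideal.Quotient.mk p.asIdeal r)

/-- The `n`-th symbolic power of a prime `p`: the contraction of `(p R_p)^n` from the
localization of `R` at `p`.  For `f` in `R`, the valuation `ν_p(f) ≥ n` iff
`f ∈ symbPow p n`; this is used below to pin down the discrete valuation `ν_p`. -/
noncomputable def symbPow {R : Type} [CommRing R] (p : PrimeSpectrum R) (n : ℕ) : Ideal R :=
  Ideal.comap (algebraMap R (Localization.AtPrime p.asIdeal))
    (Ideal.map (algebraMap R (Localization.AtPrime p.asIdeal)) p.asIdeal ^ n)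

/-- `lengthQuot Q hQ c` is the length of the module `A_Q/(c)` over the local ring `A_Q`
(the localization of `A` at the prime `Q`), expressed as the Krull dimension (= supremum of
lengths of strictly increasing chains) of its lattice of submodules, which for any module
equals its Jordan–Hölder length.  This is the order function `ord_Q(c)` of the local ring
`A_Q`. -/
noncomputable def lengthQuot {A : Type} [CommRing A] (Q : Ideal A) (hQ : Q.IsPrime) (c : A) :
    WithBot ℕ∞ :=
  haveI := hQ
  Order.krullDim (Submodule (Localization.AtPrime Q)
    (Localization.AtPrime Q ⧸ Ideal.span {algebraMap A (Localization.AtPrime Q) c}))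

namespace MilnorK2

section Symbols

variable {F : Type} [Field F]

theorem symbol_mul_left (f g h : Fˣ) : symbol (f * g) h = symbol f h + symbol g h := by
  simp only [symbol, ofMul_mul, TensorProduct.add_tmul, Submodule.Quotient.mk_add]

theorem symbol_mul_right (f g h : Fˣ) : symbol f (g * h) = symbol f g + symbol f h := by
  simp only [symbol, ofMul_mul, TensorProduct.tmul_add, Submodule.Quotient.mk_add]

theorem symbol_steinberg (f g : Fˣ) (h : (f : F) + g = 1) : symbol f g = 0 := by
  have h' : (1 : F) - f = g := by rw [← h]; ring
  have h0 : (1 : F) - f ≠ 0 := by rw [h']; exact g.ne_zero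
  have hg : g = Units.mk0 ((1 : F) - f) h0 := by ext; simp [h']
  rw [symbol, Submodule.Quotient.mk_eq_zero]
  exact Submodule.subset_span ⟨f, h0, by rw [← hg]⟩

theorem symbol_one_left (f : Fˣ) : symbol 1 f = 0 := by
  have := symbol_mul_left 1 1 f
  simpa using this

theorem symbol_one_right (f : Fˣ) : symbol f 1 = 0 := by
  have := symbol_mul_right f 1 1
  simpa using this

theorem symbol_inv_left (f g : Fˣ) : symbol f⁻¹ g = - symbol f g := by
  have := symbol_mul_left f f⁻¹ g
  rw [mul_inv_cancel, symbol_one_left] at this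
  exact (neg_eq_of_add_eq_zero_right this.symm).symm

theorem symbol_inv_right (f g : Fˣ) : symbol f g⁻¹ = - symbol f g := by
  have := symbol_mul_right f g g⁻¹
  rw [mul_inv_cancel, symbol_one_right] at this
  exact (neg_eq_of_add_eq_zero_right this.symm).symm

theorem symbol_neg_self (f : Fˣ) : symbol f (-f) = 0 := by
  by_cases hf : f = 1
  · rw [hf, symbol_one_left]
  have h1 : (1 : F) - f ≠ 0 := fun h => hf (by ext; simpa using (sub_eq_zero.mp h).symm)
  have h2 : (1 : F) - ((f⁻¹ : Fˣ) : F) ≠ 0 := fun h => hf (by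
    have : (f⁻¹ : Fˣ) = 1 := by ext; simpa using (sub_eq_zero.mp h).symm
    simpa using this)
  have e : -f = Units.mk0 _ h1 * (Units.mk0 _ h2)⁻¹ := by
    rw [eq_mul_inv_iff_mul_eq]
    ext
    have := f.ne_zero
    simp
    field_simp
    ring
  rw [e, symbol_mul_right, symbol_inv_right, ← symbol_inv_left,
    symbol_steinberg f _ (by simp), symbol_steinberg f⁻¹ _ (by simp), add_zero]

theorem symbol_self (f : Fˣ) : symbol f f = symbol f (-1) := by
  have h := symbol_mul_right f (-f) (-1)
  rw [symbol_neg_self, zero_add] at h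
  rw [← h]
  congr 1
  ext
  simp

theorem symbol_anticomm (f g : Fˣ) : symbol f g = - symbol g f := by
  have h := symbol_neg_self (f * g)
  rw [symbol_mul_left] at h
  have e1 : -(f * g) = -f * g := by ext; simp
  have e2 : -(f * g) = f * -g := by ext; simp
  nth_rw 1 [e1] at h
  rw [e2] at h
  rw [symbol_mul_right, symbol_mul_right, symbol_neg_self, symbol_neg_self, zero_add,
    add_zero] at h
  exact eq_neg_of_add_eq_zero_left h

theorem closure_symbols :
    AddSubgroup.closure {ξ : MilnorK2 F | ∃ f g : Fˣ, ξ = symbol f g} = ⊤ := by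
  rw [eq_top_iff]
  rintro ξ -
  obtain ⟨t, rfl⟩ := Submodule.Quotient.mk_surjective _ ξ
  induction t using TensorProduct.induction_on with
  | zero => exact AddSubgroup.zero_mem _
  | tmul x y => exact AddSubgroup.subset_closure ⟨x.toMul, y.toMul, rfl⟩
  | add x y hx hy => exact AddSubgroup.add_mem _ hx hy

/-- A bimultiplicative map on units, as a `ℤ`-bilinear map. -/
noncomputable def bilin {G : Type*} [AddCommGroup G] (b : Fˣ → Fˣ → G)
    (hl : ∀ f g h, b (f * g) h = b f h + b g h) (hr : ∀ f g h, b f (g * h) = b f g + b f h) :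
    Additive Fˣ →ₗ[ℤ] Additive Fˣ →ₗ[ℤ] G :=
  AddMonoidHom.toIntLinearMap
    (AddMonoidHom.mk' (fun f : Additive Fˣ => AddMonoidHom.toIntLinearMap
      (AddMonoidHom.mk' (fun g : Additive Fˣ => b f.toMul g.toMul)
        (fun g h => hr f.toMul g.toMul h.toMul)))
      (fun f g => LinearMap.ext fun h => hl f.toMul g.toMul h.toMul))

/-- A bimultiplicative map killing Steinberg relations induces a homomorphism on `K₂ᴹ`. -/
noncomputable def lift {G : Type*} [AddCommGroup G] (b : Fˣ → Fˣ → G)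
    (hl : ∀ f g h, b (f * g) h = b f h + b g h) (hr : ∀ f g h, b f (g * h) = b f g + b f h)
    (hs : ∀ f g : Fˣ, (f : F) + g = 1 → b f g = 0) : MilnorK2 F →+ G :=
  ((steinberg F).liftQ (TensorProduct.lift (bilin b hl hr)).toAddMonoidHom.toIntLinearMap (by
      rw [steinberg, Submodule.span_le]
      rintro _ ⟨f, h, rfl⟩
      rw [SetLike.mem_coe, LinearMap.mem_ker]
      exact hs f (Units.mk0 _ h) (by simp))).toAddMonoidHom

theorem lift_symbol {G : Type*} [AddCommGroup G] (b : Fˣ → Fˣ → G) (hl hr hs) (f g : Fˣ) :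
    lift b hl hr hs (symbol f g) = b f g := by
  rfl

/-- Functoriality of `K₂ᴹ`. -/
noncomputable def map {E : Type} [Field E] (σ : F →+* E) : MilnorK2 F →+ MilnorK2 E :=
  lift (fun f g => symbol (Units.map σ.toMonoidHom f) (Units.map σ.toMonoidHom g))
    (fun f g h => by rw [map_mul, symbol_mul_left])
    (fun f g h => by rw [map_mul, symbol_mul_right])
    (fun f g h => symbol_steinberg _ _ (by
      simpa using congrArg σ h))

theorem map_symbol {E : Type} [Field E] (σ : F →+* E) (f g : Fˣ) :
    map σ (symbol f g) = symbol (Units.map σ.toMonoidHom f) (Units.map σ.toMonoidHom g) :=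
  lift_symbol _ _ _ _ f g

theorem hom_ext {G : Type*} [AddCommGroup G] {φ ψ : MilnorK2 F →+ G}
    (h : ∀ f g, φ (symbol f g) = ψ (symbol f g)) : φ = ψ := by
  refine AddMonoidHom.eq_of_eqOn_dense closure_symbols ?_
  rintro _ ⟨f, g, rfl⟩
  exact h f g

theorem map_comp {E D : Type} [Field E] [Field D] (σ : F →+* E) (τ : E →+* D) :
    map (τ.comp σ) = (map τ).comp (map σ) :=
  hom_ext fun f g => by
    rw [AddMonoidHom.comp_apply, map_symbol, map_symbol, map_symbol]
    rfl

open Classical in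
/-- The symbol as a total function on `F`, with value `0` if one of the entries vanishes. -/
noncomputable def symb (f g : F) : MilnorK2 F :=
  if h : f ≠ 0 ∧ g ≠ 0 then symbol (Units.mk0 f h.1) (Units.mk0 g h.2) else 0

theorem symb_coe (f g : Fˣ) : symb (f : F) g = symbol f g := by
  rw [symb, dif_pos ⟨f.ne_zero, g.ne_zero⟩]
  simp

theorem symb_zero_left (g : F) : symb 0 g = 0 := by simp [symb]

theorem symb_zero_right (g : F) : symb g 0 = 0 := by simp [symb]

theorem symb_mul_left {f g : F} (hf : f ≠ 0) (hg : g ≠ 0) (h : F) :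
    symb (f * g) h = symb f h + symb g h := by
  by_cases hh : h = 0
  · simp [hh, symb_zero_right]
  lift f to Fˣ using hf.isUnit
  lift g to Fˣ using hg.isUnit
  lift h to Fˣ using (Ne.isUnit hh)
  rw [← Units.val_mul]
  simp only [symb_coe, symbol_mul_left]

theorem symb_mul_right (f : F) {g h : F} (hg : g ≠ 0) (hh : h ≠ 0) :
    symb f (g * h) = symb f g + symb f h := by
  by_cases hf : f = 0
  · simp [hf, symb_zero_left]
  lift f to Fˣ using (Ne.isUnit hf)
  lift g to Fˣ using hg.isUnit
  lift h to Fˣ using hh.isUnit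
  rw [← Units.val_mul]
  simp only [symb_coe, symbol_mul_right]

theorem symb_anticomm (f g : F) : symb f g = - symb g f := by
  by_cases hf : f = 0
  · simp [hf, symb_zero_left, symb_zero_right]
  by_cases hg : g = 0
  · simp [hg, symb_zero_left, symb_zero_right]
  lift f to Fˣ using (Ne.isUnit hf)
  lift g to Fˣ using (Ne.isUnit hg)
  simp only [symb_coe]
  exact symbol_anticomm f g

theorem symb_self (f : F) : symb f f = symb f (-1) := by
  by_cases hf : f = 0
  · simp [hf, symb_zero_left]
  lift f to Fˣ using (Ne.isUnit hf)
  have : (-1 : F) = ((-1 : Fˣ) : F) := by simp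
  rw [this]
  simp only [symb_coe]
  exact symbol_self f

/-- If `x + y = z` then `{x/z, y/z} = 0`, expanded. -/
theorem symb_of_add_eq {x y z : F} (hx : x ≠ 0) (hy : y ≠ 0) (hz : z ≠ 0) (h : x + y = z) :
    symb x y = symb x z + symb z y - symb z (-1) := by
  have h1 : symb z z = symb z (-1) := symb_self z
  rw [← h1]
  have key : symb (x / z) (y / z) = 0 := by
    lift x to Fˣ using hx.isUnit
    lift y to Fˣ using hy.isUnit
    lift z to Fˣ using hz.isUnit
    rw [← Units.val_div_eq_div_val, ← Units.val_div_eq_div_val, symb_coe]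
    apply symbol_steinberg
    rw [Units.val_div_eq_div_val, Units.val_div_eq_div_val, ← add_div, h, div_self hz]
  have hyz := div_ne_zero hy hz
  have hxz := div_ne_zero hx hz
  have e1 := symb_mul_left hxz hz y
  have e2 := symb_mul_right (x / z) hyz hz
  have e3 := symb_mul_left hxz hz z
  rw [div_mul_cancel₀ _ hz] at e1 e2 e3
  rw [key, zero_add] at e2
  rw [e1, e3, e2]
  abel

theorem map_symb {E : Type} [Field E] (σ : F →+* E) (f g : F) :
    map σ (symb f g) = symb (σ f) (σ g) := by
  by_cases hf : f = 0
  · simp [hf, symb_zero_left]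
  by_cases hg : g = 0
  · simp [hg, symb_zero_right]
  lift f to Fˣ using (Ne.isUnit hf)
  lift g to Fˣ using (Ne.isUnit hg)
  rw [symb_coe, map_symbol, ← symb_coe]
  rfl

end Symbols

section FractionField

variable (R : Type) {K : Type} [CommRing R] [IsDomain R] [Field K] [Algebra R K]
  [IsFractionRing R K]

theorem closure_symb_algebraMap :
    AddSubgroup.closure {ξ : MilnorK2 K | ∃ a b : R, a ≠ 0 ∧ b ≠ 0 ∧
      ξ = symb (algebraMap R K a) (algebraMap R K b)} = ⊤ := by
  have inj := IsFractionRing.injective R K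
  have ne : ∀ {a : R}, a ≠ 0 → algebraMap R K a ≠ 0 := fun h => by
    simpa using inj.ne h
  rw [eq_top_iff, ← closure_symbols, AddSubgroup.closure_le]
  rintro _ ⟨f, g, rfl⟩
  rw [← symb_coe]
  obtain ⟨a, b, hb, hf⟩ := IsFractionRing.div_surjective (A := R) (f : K)
  obtain ⟨c, d, hd, hg⟩ := IsFractionRing.div_surjective (A := R) (g : K)
  have hb := nonZeroDivisors.ne_zero hb
  have hd := nonZeroDivisors.ne_zero hd
  have ha : a ≠ 0 := by rintro rfl; exact f.ne_zero (by simp [← hf])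
  have hc : c ≠ 0 := by rintro rfl; exact g.ne_zero (by simp [← hg])
  have e1 : ∀ y, symb (f : K) y = symb (algebraMap R K a) y - symb (algebraMap R K b) y := by
    intro y
    rw [eq_sub_iff_add_eq, ← symb_mul_left f.ne_zero (ne hb), ← hf, div_mul_cancel₀ _ (ne hb)]
  have e2 : ∀ y, symb y (g : K) = symb y (algebraMap R K c) - symb y (algebraMap R K d) := by
    intro y
    rw [eq_sub_iff_add_eq, ← symb_mul_right _ g.ne_zero (ne hd), ← hg, div_mul_cancel₀ _ (ne hd)]
  rw [e1, e2, e2]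
  have mem : ∀ a b : R, a ≠ 0 → b ≠ 0 → symb (algebraMap R K a) (algebraMap R K b) ∈
      AddSubgroup.closure {ξ : MilnorK2 K | ∃ a b : R, a ≠ 0 ∧ b ≠ 0 ∧
        ξ = symb (algebraMap R K a) (algebraMap R K b)} :=
    fun a b ha hb => AddSubgroup.subset_closure ⟨a, b, ha, hb, rfl⟩
  exact sub_mem (sub_mem (mem _ _ ha hc) (mem _ _ ha hd)) (sub_mem (mem _ _ hb hc) (mem _ _ hb hd))

end FractionField

end MilnorK2

/-- A degree function on `B` over `A` with the formal properties of the degree in a polynomial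
ring, including pseudo-division. -/
structure IsPseudoDegree {A B : Type} [CommRing A] [CommRing B] (φ : A →+* B) (deg : B → ℕ) :
    Prop where
  injective : Function.Injective φ
  map : ∀ c, deg (φ c) = 0
  mul : ∀ {a b}, a ≠ 0 → b ≠ 0 → deg (a * b) = deg a + deg b
  add_le : ∀ a b, deg (a + b) ≤ max (deg a) (deg b)
  eq_map : ∀ {b}, deg b = 0 → ∃ c, φ c = b
  div : ∀ a {b}, b ≠ 0 → ∃ c, c ≠ 0 ∧ ∃ s r, φ c * a = b * s + r ∧
    (r = 0 ∨ deg r < deg b) ∧ (s = 0 ∨ deg s + deg b ≤ deg a)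

namespace IsPseudoDegree

open Polynomial in
theorem polynomial (A : Type) [CommRing A] [IsDomain A] :
    IsPseudoDegree (C : A →+* A[X]) natDegree where
  injective := C_injective
  add_le := natDegree_add_le
  map := natDegree_C
  mul := natDegree_mul
  eq_map h := ⟨_, (eq_C_of_natDegree_eq_zero h).symm⟩
  div := by
    intro a b hb
    induction hn : a.natDegree using Nat.strong_induction_on generalizing a with
    | _ n ih =>
    subst hn
    by_cases hlt : a = 0 ∨ a.natDegree < b.natDegree
    · exact ⟨1, one_ne_zero, 0, a, by simp, hlt, Or.inl rfl⟩
    push Not at hlt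
    obtain ⟨ha, hlt⟩ := hlt
    have hlb : b.leadingCoeff ≠ 0 := leadingCoeff_ne_zero.mpr hb
    have hla : a.leadingCoeff ≠ 0 := leadingCoeff_ne_zero.mpr ha
    set k := a.natDegree - b.natDegree with hk
    set t : A[X] := C a.leadingCoeff * X ^ k with ht
    have htdeg : t.natDegree = k := natDegree_C_mul_X_pow _ _ hla
    have ht0 : t ≠ 0 := by
      rw [ht]; exact mul_ne_zero (C_ne_zero.mpr hla) (pow_ne_zero _ X_ne_zero)
    set a' := C b.leadingCoeff * a - b * t with ha'
    have hrel : C b.leadingCoeff * a = b * t + a' := by rw [ha']; ring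
    have hdeg : a' = 0 ∨ a'.natDegree < a.natDegree := by
      by_cases h0 : a' = 0
      · exact Or.inl h0
      right
      apply natDegree_lt_natDegree h0
      have hp : C b.leadingCoeff * a ≠ 0 := mul_ne_zero (C_ne_zero.mpr hlb) ha
      have e1 : (C b.leadingCoeff * a).degree = a.degree := by
        rw [degree_C_mul hlb]
      rw [← e1]
      apply degree_sub_lt_left _ hp
      · rw [leadingCoeff_mul, leadingCoeff_mul, leadingCoeff_C, ht, leadingCoeff_C_mul_X_pow]
      · rw [e1, degree_mul, degree_eq_natDegree ha, degree_eq_natDegree hb,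
          degree_eq_natDegree ht0, htdeg, ← Nat.cast_add]
        congr 1
        omega
    rcases hdeg with h0 | hdeg
    · refine ⟨b.leadingCoeff, hlb, t, 0, by rw [hrel, h0], Or.inl rfl, Or.inr ?_⟩
      rw [htdeg]; omega
    · obtain ⟨c, hc, s, r, h, hr, hs⟩ := ih _ hdeg a' rfl
      refine ⟨c * b.leadingCoeff, mul_ne_zero hc hlb, C c * t + s, r, ?_, hr, Or.inr ?_⟩
      · rw [C_mul, mul_assoc, hrel, mul_add, h]; ring
      · have h1 : (C c * t).natDegree ≤ k := (natDegree_C_mul_le _ _).trans htdeg.le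
        have h2 : s.natDegree ≤ k := by
          rcases hs with rfl | hs
          · simp
          · omega
        have := natDegree_add_le_of_degree_le h1 h2
        omega

theorem of_equiv {A B : Type} [CommRing A] [IsDomain A] [CommRing B]
    (φ : A →+* B) (e : Polynomial A ≃+* B) (he : ∀ c, e (Polynomial.C c) = φ c) :
    IsPseudoDegree φ (fun b => (e.symm b).natDegree) where
  injective := fun x y h => Polynomial.C_injective (e.injective (by rw [he, he, h]))
  map c := by rw [← he, e.symm_apply_apply, Polynomial.natDegree_C]
  mul := fun {a b} ha hb => by
    rw [map_mul, (polynomial A).mul (by simpa using ha) (by simpa using hb)]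
  add_le a b := by rw [map_add]; exact Polynomial.natDegree_add_le _ _
  eq_map := fun {b} h => by
    obtain ⟨c, hc⟩ := (polynomial A).eq_map h
    exact ⟨c, by rw [← he, hc, e.apply_symm_apply]⟩
  div := fun a b hb => by
    obtain ⟨c, hc, s, r, h, hr, hs⟩ := (polynomial A).div (e.symm a) (b := e.symm b)
      (by simpa using hb)
    refine ⟨c, hc, e s, e r, ?_, ?_, ?_⟩
    · rw [← he]
      apply e.symm.injective
      simpa using h
    · simpa using hr
    · simpa using hs

section

variable {A B : Type} [CommRing A] [CommRing B] {φ : A →+* B}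
  {deg : B → ℕ} (h : IsPseudoDegree φ deg)
include h

theorem map_ne_zero {c : A} (hc : c ≠ 0) : φ c ≠ 0 := by
  rw [← map_zero φ]
  exact h.injective.ne hc

theorem isUnit [IsDomain B] {u : B} (hu : IsUnit u) : deg u = 0 := by
  obtain ⟨v, hv⟩ := hu.exists_right_inv
  have hv0 : v ≠ 0 := by rintro rfl; simp at hv
  have := h.mul hu.ne_zero hv0
  rw [hv, ← map_one φ, h.map] at this
  omega

theorem le_of_dvd {a b : B} (hb : b ≠ 0) (hab : a ∣ b) : deg a ≤ deg b := by
  obtain ⟨c, rfl⟩ := hab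
  rw [h.mul (left_ne_zero_of_mul hb) (right_ne_zero_of_mul hb)]
  omega

theorem neg [IsDomain B] (b : B) : deg (-b) = deg b := by
  by_cases hb : b = 0
  · rw [hb, neg_zero]
  · rw [← neg_one_mul, h.mul (by simp) hb, show (-1 : B) = φ (-1) by simp, h.map, zero_add]

theorem sub_le [IsDomain B] (a b : B) : deg (a - b) ≤ max (deg a) (deg b) := by
  rw [sub_eq_add_neg, ← h.neg b]
  exact h.add_le a (-b)

/-- A nonzero ideal contracting to zero is, up to denominators, generated by any of its
nonzero elements of minimal degree. -/
theorem exists_generator {I : Ideal B} (hI : I ≠ ⊥) :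
    ∃ g ∈ I, g ≠ 0 ∧ ∀ a ∈ I, ∃ c, c ≠ 0 ∧ ∃ s, φ c * a = g * s := by
  classical
  obtain ⟨x, hx, hx0⟩ := I.ne_bot_iff.mp hI
  have hex : ∃ n, ∃ g ∈ I, g ≠ 0 ∧ deg g = n := ⟨_, x, hx, hx0, rfl⟩
  obtain ⟨g, hg, hg0, hn⟩ := Nat.find_spec hex
  refine ⟨g, hg, hg0, fun a ha => ?_⟩
  obtain ⟨c, hc, s, r, hdiv, hr, -⟩ := h.div a hg0
  refine ⟨c, hc, s, ?_⟩
  have hrI : r ∈ I := by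
    have : r = φ c * a - g * s := by rw [hdiv]; ring
    rw [this]
    exact I.sub_mem (I.mul_mem_left _ ha) (I.mul_mem_right _ hg)
  have hr0 : r = 0 := by
    by_contra h0
    exact Nat.find_min hex (hn ▸ hr.resolve_left h0) ⟨r, hrI, h0, rfl⟩
  rw [hdiv, hr0, add_zero]

/-- A fraction `a / b` is either a fraction of elements of the base, or one can find a
representation and a prime over zero containing exactly one of the two entries. -/
theorem exists_fraction [IsDomain A] [IsDomain B] (a b : B) (ha : a ≠ 0) (hb : b ≠ 0) :
    ∃ a' b' : B, a' ≠ 0 ∧ b' ≠ 0 ∧ a * b' = a' * b ∧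
      ((∃ x y, φ x = a' ∧ φ y = b') ∨ ∃ Q : Ideal B, Q.IsPrime ∧ Q.comap φ = ⊥ ∧
        ((a' ∈ Q ∧ b' ∉ Q) ∨ (b' ∈ Q ∧ a' ∉ Q))) := by
  induction hn : deg a + deg b using Nat.strong_induction_on generalizing a b with
  | _ n ih =>
  subst hn
  by_cases hcop : ∀ c : A, c ≠ 0 → φ c ∉ Ideal.span {a, b}
  · obtain ⟨g, hg, hg0, hgen⟩ := h.exists_generator (I := Ideal.span {a, b})
      (fun hbot => ha (by
        have : a ∈ Ideal.span {a, b} := Ideal.subset_span (by simp)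
        rwa [hbot] at this))
    obtain ⟨c, hc, s, hs⟩ := hgen a (Ideal.subset_span (by simp))
    obtain ⟨c', hc', s', hs'⟩ := hgen b (Ideal.subset_span (by simp))
    have hgdeg : deg g ≠ 0 := by
      intro h0
      obtain ⟨d, rfl⟩ := h.eq_map h0
      exact hcop d (by rintro rfl; simp at hg0) hg
    have hs0 : s ≠ 0 := by
      rintro rfl
      exact mul_ne_zero (h.map_ne_zero hc) ha (by simpa using hs)
    have hs0' : s' ≠ 0 := by
      rintro rfl
      exact mul_ne_zero (h.map_ne_zero hc') hb (by simpa using hs')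
    have d1 := congrArg deg hs
    have d2 := congrArg deg hs'
    rw [h.mul (h.map_ne_zero hc) ha, h.mul hg0 hs0, h.map] at d1
    rw [h.mul (h.map_ne_zero hc') hb, h.mul hg0 hs0', h.map] at d2
    have hx0 : φ c' * s ≠ 0 := mul_ne_zero (h.map_ne_zero hc') hs0
    have hy0 : φ c * s' ≠ 0 := mul_ne_zero (h.map_ne_zero hc) hs0'
    obtain ⟨a', b', ha', hb', hrel, hcase⟩ := ih (deg (φ c' * s) + deg (φ c * s'))
      (by
        rw [h.mul (h.map_ne_zero hc') hs0, h.mul (h.map_ne_zero hc) hs0', h.map, h.map]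
        omega) _ _ hx0 hy0 rfl
    refine ⟨a', b', ha', hb', ?_, hcase⟩
    apply mul_left_cancel₀ (mul_ne_zero (mul_ne_zero (h.map_ne_zero hc) (h.map_ne_zero hc')) hg0)
    calc φ c * φ c' * g * (a * b') = (φ c * a) * φ c' * g * b' := by ring
      _ = g * g * ((φ c' * s) * b') := by rw [hs]; ring
      _ = g * φ c * a' * (g * s') := by rw [hrel]; ring
      _ = _ := by rw [← hs']; ring
  · push Not at hcop
    obtain ⟨d, hd, hdI⟩ := hcop
    have key : ∀ a b : B, a ≠ 0 → deg a ≠ 0 → φ d ∈ Ideal.span {a, b} →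
        ∃ Q : Ideal B, Q.IsPrime ∧ Q.comap φ = ⊥ ∧ a ∈ Q ∧ b ∉ Q := by
      intro a b ha hdeg hdI
      obtain ⟨Q, hQ, haQ, hdisj⟩ := Ideal.exists_le_prime_disjoint (Ideal.span {a})
        ((nonZeroDivisors A).map φ) (by
          rw [Set.disjoint_left]
          rintro x hx ⟨c, hc, rfl⟩
          have hc := nonZeroDivisors.ne_zero hc
          have := h.le_of_dvd (h.map_ne_zero hc) (Ideal.mem_span_singleton.mp hx)
          rw [h.map] at this
          omega)
      have hcomap : Q.comap φ = ⊥ := by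
        rw [eq_bot_iff]
        intro c hc
        by_contra h0
        exact Set.disjoint_left.mp hdisj hc ⟨c, mem_nonZeroDivisors_of_ne_zero h0, rfl⟩
      have haQ' : a ∈ Q := haQ (Ideal.mem_span_singleton_self a)
      refine ⟨Q, hQ, hcomap, haQ', fun hbQ => hd ?_⟩
      have hle : Ideal.span {a, b} ≤ Q := by
        rw [Ideal.span_le]
        rintro x (rfl | rfl)
        exacts [haQ', hbQ]
      have : d ∈ Q.comap φ := hle hdI
      rwa [hcomap] at this
    refine ⟨a, b, ha, hb, rfl, ?_⟩
    by_cases hda : deg a = 0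
    · by_cases hdb : deg b = 0
      · obtain ⟨x, hx⟩ := h.eq_map hda
        obtain ⟨y, hy⟩ := h.eq_map hdb
        exact Or.inl ⟨x, y, hx, hy⟩
      · obtain ⟨Q, h1, h2, h3, h4⟩ := key b a hb hdb (by rwa [Set.pair_comm])
        exact Or.inr ⟨Q, h1, h2, Or.inr ⟨h3, h4⟩⟩
    · obtain ⟨Q, h1, h2, h3, h4⟩ := key a b ha hda hdI
      exact Or.inr ⟨Q, h1, h2, Or.inl ⟨h3, h4⟩⟩

end

end IsPseudoDegree

namespace MilnorK2

section RingSymbols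

variable {S : Type} [CommRing S] [IsDomain S] (E : Type) [Field E] [Algebra S E]

/-- The symbol in `K₂ᴹ(E)` of two elements of a ring mapping to `E`. -/
noncomputable def rsymb (a b : S) : MilnorK2 E := symb (algebraMap S E a) (algebraMap S E b)

variable [IsFractionRing S E]

theorem algebraMap_ne_zero {a : S} (ha : a ≠ 0) : algebraMap S E a ≠ 0 := by
  simpa using (IsFractionRing.injective S E).ne ha

theorem rsymb_mul_left {a b : S} (ha : a ≠ 0) (hb : b ≠ 0) (c : S) :
    rsymb E (a * b) c = rsymb E a c + rsymb E b c := by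
  rw [rsymb, map_mul, symb_mul_left (algebraMap_ne_zero E ha) (algebraMap_ne_zero E hb)]
  rfl

theorem rsymb_mul_right (a : S) {b c : S} (hb : b ≠ 0) (hc : c ≠ 0) :
    rsymb E a (b * c) = rsymb E a b + rsymb E a c := by
  rw [rsymb, map_mul, symb_mul_right _ (algebraMap_ne_zero E hb) (algebraMap_ne_zero E hc)]
  rfl

omit [IsDomain S] [IsFractionRing S E]

theorem rsymb_anticomm (a b : S) : rsymb E a b = - rsymb E b a := symb_anticomm _ _

theorem rsymb_self (a : S) : rsymb E a a = rsymb E a (-1) := by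
  rw [rsymb, symb_self, rsymb, map_neg, map_one]

theorem rsymb_zero_left (a : S) : rsymb E 0 a = 0 := by rw [rsymb, map_zero, symb_zero_left]

theorem rsymb_zero_right (a : S) : rsymb E a 0 = 0 := by rw [rsymb, map_zero, symb_zero_right]

theorem rsymb_one_right (a : S) : rsymb E a 1 = 0 := by
  by_cases ha : algebraMap S E a = 0
  · rw [rsymb, ha, symb_zero_left]
  · lift algebraMap S E a to Eˣ using (Ne.isUnit ha) with u hu
    rw [rsymb, ← hu, map_one, ← Units.val_one, symb_coe, symbol_one_right]

variable [IsDomain S] [IsFractionRing S E]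

theorem rsymb_of_add_eq {x y z : S} (hx : x ≠ 0) (hy : y ≠ 0) (hz : z ≠ 0) (h : x + y = z) :
    rsymb E x y = rsymb E x z + rsymb E z y - rsymb E z (-1) := by
  have := symb_of_add_eq (algebraMap_ne_zero E hx) (algebraMap_ne_zero E hy)
    (algebraMap_ne_zero E hz) (by rw [← map_add, h])
  rw [rsymb, this, rsymb, rsymb, rsymb, map_neg, map_one]

theorem closure_rsymb :
    AddSubgroup.closure {ξ : MilnorK2 E | ∃ a b : S, a ≠ 0 ∧ b ≠ 0 ∧ ξ = rsymb E a b} = ⊤ :=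
  closure_symb_algebraMap S

end RingSymbols

section Filtration

variable {S : Type} [CommRing S] (E : Type) [Field E] [Algebra S E] (deg : S → ℕ)

/-- The subgroup of `K₂ᴹ(E)` generated by symbols of elements of degree at most `d`. -/
noncomputable def filtration (d : ℕ) : AddSubgroup (MilnorK2 E) :=
  AddSubgroup.closure {ξ | ∃ a b : S, deg a ≤ d ∧ deg b ≤ d ∧ ξ = rsymb E a b}

variable {deg}

theorem rsymb_mem_filtration {d : ℕ} {a b : S} (ha : deg a ≤ d) (hb : deg b ≤ d) :
    rsymb E a b ∈ filtration E deg d :=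
  AddSubgroup.subset_closure ⟨a, b, ha, hb, rfl⟩

variable (deg) in
theorem filtration_mono : Monotone (filtration E deg) := fun d d' h =>
  AddSubgroup.closure_mono (by
    rintro _ ⟨a, b, ha, hb, rfl⟩
    exact ⟨a, b, ha.trans h, hb.trans h, rfl⟩)

variable (deg) in
theorem exists_mem_filtration [IsDomain S] [IsFractionRing S E] (ξ : MilnorK2 E) :
    ∃ d, ξ ∈ filtration E deg d := by
  have hξ : ξ ∈ AddSubgroup.closure
      {ξ : MilnorK2 E | ∃ a b : S, a ≠ 0 ∧ b ≠ 0 ∧ ξ = rsymb E a b} := by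
    rw [closure_rsymb]; trivial
  induction hξ using AddSubgroup.closure_induction with
  | mem x hx =>
    obtain ⟨a, b, -, -, rfl⟩ := hx
    exact ⟨max (deg a) (deg b), rsymb_mem_filtration E (le_max_left _ _) (le_max_right _ _)⟩
  | zero => exact ⟨0, zero_mem _⟩
  | add x y _ _ hx hy =>
    obtain ⟨d, hd⟩ := hx
    obtain ⟨d', hd'⟩ := hy
    exact ⟨max d d', add_mem (filtration_mono E deg (le_max_left _ _) hd)
      (filtration_mono E deg (le_max_right _ _) hd')⟩
  | neg x _ hx =>
    obtain ⟨d, hd⟩ := hx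
    exact ⟨d, neg_mem hd⟩

variable {R : Type} [CommRing R] {φ : R →+* S} (h : IsPseudoDegree φ deg)
include h

theorem filtration_zero_le {F : Type} [Field F] [Algebra R F] (σ : F →+* E)
    (hσ : ∀ r, σ (algebraMap R F r) = algebraMap S E (φ r)) :
    filtration E deg 0 ≤ (map σ).range := by
  rw [filtration, AddSubgroup.closure_le]
  rintro _ ⟨a, b, ha, hb, rfl⟩
  obtain ⟨x, rfl⟩ := h.eq_map (Nat.le_zero.mp ha)
  obtain ⟨y, rfl⟩ := h.eq_map (Nat.le_zero.mp hb)
  exact ⟨symb (algebraMap R F x) (algebraMap R F y), by rw [map_symb, hσ, hσ]; rfl⟩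

variable [IsDomain S] [IsFractionRing S E]

/-- Modulo lower filtration, `{π, g} + {π, g'}` is again of the same form, where the entries
`g`, `g'` are of degree less than that of `π`. -/
theorem exists_rsymb_add {d : ℕ} {π : S} (hπ : Prime π) (hd : deg π = d + 1) {g g' : S}
    (hg0 : g ≠ 0) (hg : deg g ≤ d) (hg0' : g' ≠ 0) (hg' : deg g' ≤ d) :
    ∃ r : S, r ≠ 0 ∧ deg r ≤ d ∧ ∃ c : R, c ≠ 0 ∧
      rsymb E π g + rsymb E π g' + rsymb E π (φ c) - rsymb E π r ∈ filtration E deg d := by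
  have lower : ∀ a : S, a ≠ 0 → deg a ≤ d → ¬ π ∣ a := fun a ha0 ha hdvd => by
    have := h.le_of_dvd ha0 hdvd
    omega
  obtain ⟨c, hc, s, r, hdiv, hr, hs⟩ := h.div (g * g') hπ.ne_zero
  have hφc := h.map_ne_zero hc
  have hz0 : φ c * (g * g') ≠ 0 := mul_ne_zero hφc (mul_ne_zero hg0 hg0')
  have hr0 : r ≠ 0 := by
    rintro rfl
    rw [add_zero] at hdiv
    have : π ∣ φ c * (g * g') := ⟨s, hdiv⟩
    rcases hπ.dvd_or_dvd this with h1 | h1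
    · exact lower _ hφc (by rw [h.map]; omega) h1
    · rcases hπ.dvd_or_dvd h1 with h1 | h1
      · exact lower _ hg0 hg h1
      · exact lower _ hg0' hg' h1
  have hrd : deg r ≤ d := by
    have := hr.resolve_left hr0
    omega
  refine ⟨r, hr0, hrd, c, hc, ?_⟩
  have hexp : rsymb E π g + rsymb E π g' + rsymb E π (φ c) = rsymb E π (φ c * (g * g')) := by
    rw [rsymb_mul_right E π hφc (mul_ne_zero hg0 hg0'), rsymb_mul_right E π hg0 hg0']
    abel
  rw [hexp]
  by_cases hs0 : s = 0
  · rw [hs0, mul_zero, zero_add] at hdiv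
    rw [hdiv, sub_self]
    exact zero_mem _
  have hsd : deg s ≤ d := by
    have := hs.resolve_left hs0
    rw [h.mul hg0 hg0'] at this
    omega
  have key := rsymb_of_add_eq E (mul_ne_zero hπ.ne_zero hs0) hr0 hz0 hdiv.symm
  rw [rsymb_mul_left E hπ.ne_zero hs0, rsymb_mul_left E hπ.ne_zero hs0] at key
  have hφd : deg (φ c) ≤ d := by rw [h.map]; omega
  have hprod : ∀ y : S, deg y ≤ d → rsymb E (φ c * (g * g')) y ∈ filtration E deg d := by
    intro y hy
    rw [rsymb_mul_left E hφc (mul_ne_zero hg0 hg0'), rsymb_mul_left E hg0 hg0']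
    exact add_mem (rsymb_mem_filtration E hφd hy)
      (add_mem (rsymb_mem_filtration E hg hy) (rsymb_mem_filtration E hg' hy))
  have hneg : deg (-1 : S) ≤ d := by
    rw [show (-1 : S) = φ (-1) by simp, h.map]; omega
  have e : rsymb E π (φ c * (g * g')) - rsymb E π r = rsymb E s r
      - rsymb E s (φ c * (g * g')) - rsymb E (φ c * (g * g')) r
      + rsymb E (φ c * (g * g')) (-1) := by
    linear_combination (norm := module) (-1 : ℤ) • key
  rw [e, rsymb_anticomm E s (φ c * (g * g'))]
  exact add_mem (sub_mem (sub_mem (rsymb_mem_filtration E hsd hrd) (neg_mem (hprod s hsd)))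
    (hprod r hrd)) (hprod _ hneg)

/-- The subgroup of elements congruent to a symbol `{π, g / g'}` modulo lower filtration, with
`g`, `g'` of degree less than that of `π`. -/
noncomputable def layer {d : ℕ} {π : S} (hπ : Prime π) (hd : deg π = d + 1) [IsDomain R] :
    AddSubgroup (MilnorK2 E) where
  carrier := {x | ∃ g g' : S, g ≠ 0 ∧ g' ≠ 0 ∧ deg g ≤ d ∧ deg g' ≤ d ∧
    x - (rsymb E π g - rsymb E π g') ∈ filtration E deg d}
  zero_mem' := by
    have : deg (1 : S) ≤ d := by rw [← map_one φ, h.map]; omega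
    exact ⟨1, 1, one_ne_zero, one_ne_zero, this, this, by simp [zero_mem]⟩
  neg_mem' := by
    rintro x ⟨g, g', h1, h2, h3, h4, h5⟩
    refine ⟨g', g, h2, h1, h4, h3, ?_⟩
    have := neg_mem h5
    convert this using 1
    abel
  add_mem' := by
    rintro x y ⟨g, g', g0, g0', hg, hg', hx⟩ ⟨k, k', k0, k0', hk, hk', hy⟩
    obtain ⟨r, r0, hr, c, hc, h1⟩ := exists_rsymb_add E h hπ hd g0 hg k0 hk
    obtain ⟨r', r0', hr', c', hc', h2⟩ := exists_rsymb_add E h hπ hd g0' hg' k0' hk'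
    refine ⟨φ c' * r, φ c * r', mul_ne_zero (h.map_ne_zero hc') r0,
      mul_ne_zero (h.map_ne_zero hc) r0', ?_, ?_, ?_⟩
    · rw [h.mul (h.map_ne_zero hc') r0, h.map]; omega
    · rw [h.mul (h.map_ne_zero hc) r0', h.map]; omega
    · rw [rsymb_mul_right E _ (h.map_ne_zero hc') r0, rsymb_mul_right E _ (h.map_ne_zero hc) r0']
      have := sub_mem (add_mem (add_mem hx hy) h1) h2
      convert this using 1
      abel

end Filtration

end MilnorK2

section Primes

variable {S : Type} [CommRing S]

theorem H1.height (P : H1 S) : P.1.asIdeal.height = 1 := by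
  rw [PrimeSpectrum.height_eq_orderHeight]; exact P.2

theorem H2.height (P : H2 S) : P.1.asIdeal.height = 2 := by
  rw [PrimeSpectrum.height_eq_orderHeight]; exact P.2

/-- A prime ideal of height one as a point. -/
def H1.mk (P : Ideal S) [hP : P.IsPrime] (h : P.height = 1) : H1 S :=
  ⟨⟨P, hP⟩, by rw [← PrimeSpectrum.height_eq_orderHeight]; exact h⟩

/-- A prime ideal of height two as a point. -/
def H2.mk (P : Ideal S) [hP : P.IsPrime] (h : P.height = 2) : H2 S :=
  ⟨⟨P, hP⟩, by rw [← PrimeSpectrum.height_eq_orderHeight]; exact h⟩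

theorem H1.ext_ideal {P Q : H1 S} (h : P.1.asIdeal = Q.1.asIdeal) : P = Q :=
  Subtype.ext (PrimeSpectrum.ext h)

theorem H2.ext_ideal {P Q : H2 S} (h : P.1.asIdeal = Q.1.asIdeal) : P = Q :=
  Subtype.ext (PrimeSpectrum.ext h)

theorem H1.eq_of_le {P Q : H1 S} (h : P.1.asIdeal ≤ Q.1.asIdeal) : P = Q := by
  have : P.1.asIdeal.FiniteHeight := ⟨Or.inr (by rw [P.height]; simp)⟩
  exact H1.ext_ideal (Ideal.eq_of_le_of_height_le _ h (by rw [P.height, Q.height]))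

theorem H2.eq_of_le {P Q : H2 S} (h : P.1.asIdeal ≤ Q.1.asIdeal) : P = Q := by
  have : P.1.asIdeal.FiniteHeight := ⟨Or.inr (by rw [P.height]; simp)⟩
  exact H2.ext_ideal (Ideal.eq_of_le_of_height_le _ h (by rw [P.height, Q.height]))

variable [IsDomain S]

theorem H1.ne_bot (P : H1 S) : P.1.asIdeal ≠ ⊥ := by
  intro h
  have := P.height
  rw [h, Ideal.height_bot] at this
  exact zero_ne_one this

theorem H1.exists_generator [UniqueFactorizationMonoid S] (P : H1 S) :
    ∃ π, Prime π ∧ P.1.asIdeal = Ideal.span {π} := by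
  obtain ⟨x, hx, hxp⟩ := P.1.isPrime.exists_mem_prime_of_ne_bot P.ne_bot
  exact ⟨x, hxp, P.1.asIdeal.eq_span_singleton_of_height_eq_one P.height hx hxp⟩

/-- A prime element generating a prime ideal of height one. -/
noncomputable def H1.gen [UniqueFactorizationMonoid S] (P : H1 S) : S := P.exists_generator.choose

theorem H1.prime_gen [UniqueFactorizationMonoid S] (P : H1 S) : Prime P.gen :=
  P.exists_generator.choose_spec.1

theorem H1.eq_span_gen [UniqueFactorizationMonoid S] (P : H1 S) :
    P.1.asIdeal = Ideal.span {P.gen} :=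
  P.exists_generator.choose_spec.2

theorem H1.mem_iff_gen_dvd [UniqueFactorizationMonoid S] (P : H1 S) {a : S} :
    a ∈ P.1.asIdeal ↔ P.gen ∣ a := by
  rw [P.eq_span_gen, Ideal.mem_span_singleton]

/-- The point defined by a prime element. -/
def H1.ofPrime [IsNoetherianRing S] {π : S} (hπ : Prime π) : H1 S :=
  haveI := (Ideal.span_singleton_prime hπ.ne_zero).mpr hπ
  H1.mk (Ideal.span {π}) (Ideal.height_span_singleton_eq_one_of_mem_nonZeroDivisors
    (mem_nonZeroDivisors_of_ne_zero hπ.ne_zero) hπ.not_isUnit)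

theorem H1.ofPrime_asIdeal [IsNoetherianRing S] {π : S} (hπ : Prime π) :
    (H1.ofPrime hπ).1.asIdeal = Ideal.span {π} := rfl

theorem H1.gen_notMem [UniqueFactorizationMonoid S] {P Q : H1 S} (h : P ≠ Q) :
    P.gen ∉ Q.1.asIdeal := by
  intro hmem
  apply h
  apply H1.eq_of_le
  rw [P.eq_span_gen, Ideal.span_singleton_le_iff_mem]
  exact hmem

end Primes

section Residues

variable {R : Type} [CommRing R] (p : PrimeSpectrum R)

theorem resid_eq_zero_iff {a : R} : resid p a = 0 ↔ a ∈ p.asIdeal := by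
  rw [resid, FaithfulSMul.algebraMap_eq_zero_iff, Ideal.Quotient.eq_zero_iff_mem]

theorem resid_mul (a b : R) : resid p (a * b) = resid p a * resid p b := by
  simp [resid]

theorem resid_sub (a b : R) : resid p (a - b) = resid p a - resid p b := by
  simp [resid]

/-- The residue class of an element outside a prime as a unit of the residue field. -/
noncomputable def residUnit (a : R) (h : a ∉ p.asIdeal) : (kappa p)ˣ :=
  Units.mk0 (resid p a) (by rwa [Ne, resid_eq_zero_iff])

theorem residUnit_val (a : R) (h : a ∉ p.asIdeal) : (residUnit p a h : kappa p) = resid p a := rfl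

theorem residUnit_mul (a b : R) (h : a * b ∉ p.asIdeal) (ha : a ∉ p.asIdeal)
    (hb : b ∉ p.asIdeal) : residUnit p (a * b) h = residUnit p a ha * residUnit p b hb :=
  Units.ext (by simp [residUnit_val, resid_mul])

theorem residUnit_eq_iff {a b : R} (ha : a ∉ p.asIdeal) (hb : b ∉ p.asIdeal) :
    residUnit p a ha = residUnit p b hb ↔ a - b ∈ p.asIdeal := by
  rw [Units.ext_iff, residUnit_val, residUnit_val, ← sub_eq_zero, ← resid_sub, resid_eq_zero_iff]

theorem exists_residUnit_div (u : (kappa p)ˣ) : ∃ (a b : R) (ha : a ∉ p.asIdeal)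
    (hb : b ∉ p.asIdeal), u = residUnit p a ha / residUnit p b hb := by
  obtain ⟨x, y, hy, hxy⟩ := IsFractionRing.div_surjective (A := R ⧸ p.asIdeal) (u : kappa p)
  obtain ⟨a, rfl⟩ := Ideal.Quotient.mk_surjective x
  obtain ⟨b, rfl⟩ := Ideal.Quotient.mk_surjective y
  have hb : b ∉ p.asIdeal := by
    rw [← Ideal.Quotient.eq_zero_iff_mem]
    exact nonZeroDivisors.ne_zero hy
  have ha : a ∉ p.asIdeal := by
    intro h
    rw [Ideal.Quotient.eq_zero_iff_mem.mpr h, map_zero, zero_div] at hxy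
    exact u.ne_zero hxy.symm
  exact ⟨a, b, ha, hb, Units.ext (by rw [Units.val_div_eq_div_val]; exact hxy.symm)⟩

end Residues

/-- The length of the local ring at `Q` modulo the ideal generated by `I`. -/
noncomputable def localLength {R : Type} [CommRing R] (Q : Ideal R) [Q.IsPrime] (I : Ideal R) :
    ℕ∞ :=
  Module.length (Localization.AtPrime Q)
    (Localization.AtPrime Q ⧸ I.map (algebraMap R (Localization.AtPrime Q)))

/-- A pair of homomorphisms computing tame symbols and divisors. -/
structure GerstenData (R : Type) [CommRing R] [IsDomain R] [DecidableEq (H1 R)]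
    (K : Type) [Field K] [Algebra R K] where
  tame : MilnorK2 K →+ DirectSum (H1 R) (fun p => Additive (kappa p.1)ˣ)
  dv : DirectSum (H1 R) (fun p => Additive (kappa p.1)ˣ) →+ (H2 R →₀ ℤ)
  tame_unit : ∀ (p : H1 R) (a b : R), a ∉ p.1.asIdeal → b ∉ p.1.asIdeal →
    tame (MilnorK2.rsymb K a b) p = 0
  tame_gen : ∀ (p : H1 R) (π : R), p.1.asIdeal = Ideal.span {π} →
    ∀ (g : R) (hg : g ∉ p.1.asIdeal),
      tame (MilnorK2.rsymb K π g) p = Additive.ofMul (residUnit p.1 g hg)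
  dv_of : ∀ (p : H1 R) (a : R) (ha : a ∉ p.1.asIdeal) (q : H2 R) (m : ℕ),
    localLength q.1.asIdeal (p.1.asIdeal ⊔ Ideal.span {a}) = m →
      dv (DirectSum.of (fun p : H1 R => Additive (kappa p.1)ˣ) p
        (Additive.ofMul (residUnit p.1 a ha))) q = m

namespace MilnorK2

section Decomposition

variable {R S : Type} [CommRing R] [CommRing S] [IsDomain R] [IsDomain S]
  (E : Type) [Field E] [Algebra S E] [IsFractionRing S E] {deg : S → ℕ}
  {φ : R →+* S} (h : IsPseudoDegree φ deg)
include h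

theorem rsymb_mem_layer {d : ℕ} {π : S} (hπ : Prime π) (hd : deg π = d + 1) {g : S}
    (hg0 : g ≠ 0) (hg : deg g ≤ d) : rsymb E π g ∈ layer E h hπ hd := by
  have : deg (1 : S) ≤ d := by rw [← map_one φ, h.map]; omega
  exact ⟨g, 1, hg0, one_ne_zero, hg, this, by simp [rsymb_one_right, zero_mem]⟩

omit [IsDomain R] [IsDomain S] in
theorem deg_eq_of_associated {a b : S} (ha : a ≠ 0) (hab : Associated a b) : deg a = deg b :=
  le_antisymm (h.le_of_dvd (fun hb => ha (by rwa [hb, associated_zero_iff_eq_zero] at hab)) hab.dvd)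
    (h.le_of_dvd ha hab.symm.dvd)

omit [IsDomain R] in
/-- To check a multiplicative property in bounded degree it suffices to consider elements of
smaller degree and the chosen prime elements. -/
theorem mul_induction [UniqueFactorizationMonoid S] [IsNoetherianRing S] {d : ℕ} (C : S → Prop)
    (hmul : ∀ a b, a ≠ 0 → b ≠ 0 → C a → C b → C (a * b))
    (hlow : ∀ a, a ≠ 0 → deg a ≤ d → C a)
    (hgen : ∀ P : H1 S, deg P.gen = d + 1 → C P.gen)
    (a : S) (ha : a ≠ 0) (hd : deg a ≤ d + 1) : C a := by
  induction a using UniqueFactorizationMonoid.induction_on_prime with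
  | h₁ => exact (ha rfl).elim
  | h₂ x hx => exact hlow x ha (by rw [h.isUnit hx]; omega)
  | h₃ a p ha0 hp ih =>
    rw [h.mul hp.ne_zero ha0] at hd
    refine hmul _ _ hp.ne_zero ha0 ?_ (ih ha0 (by omega))
    by_cases hpd : deg p ≤ d
    · exact hlow p hp.ne_zero hpd
    · have hass : Associated (H1.ofPrime hp).gen p := by
        rw [← Ideal.span_singleton_eq_span_singleton, ← H1.eq_span_gen, H1.ofPrime_asIdeal]
      obtain ⟨u, hu⟩ := hass
      have hdeg := deg_eq_of_associated h (H1.prime_gen _).ne_zero ⟨u, hu⟩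
      rw [← hu]
      exact hmul _ _ (H1.prime_gen _).ne_zero u.ne_zero (hgen _ (by omega))
        (hlow _ u.ne_zero (by rw [h.isUnit u.isUnit]; omega))

theorem exists_finsupp_of_mem_filtration [UniqueFactorizationMonoid S] [IsNoetherianRing S]
    {d : ℕ} {ξ : MilnorK2 E} (hξ : ξ ∈ filtration E deg (d + 1)) :
    ∃ x : {P : H1 S // deg P.gen = d + 1} →₀ MilnorK2 E,
      (∀ i, x i ∈ layer E h i.1.prime_gen i.2) ∧
        ξ - x.sum (fun _ y => y) ∈ filtration E deg d := by
  classical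
  let D : AddSubgroup (MilnorK2 E) :=
    { carrier := {ξ | ∃ x : {P : H1 S // deg P.gen = d + 1} →₀ MilnorK2 E,
        (∀ i, x i ∈ layer E h i.1.prime_gen i.2) ∧
          ξ - x.sum (fun _ y => y) ∈ filtration E deg d}
      zero_mem' := ⟨0, fun i => zero_mem _, by simp [zero_mem]⟩
      add_mem' := by
        rintro a b ⟨x, hx, hx'⟩ ⟨y, hy, hy'⟩
        refine ⟨x + y, fun i => add_mem (hx i) (hy i), ?_⟩
        rw [Finsupp.sum_add_index' (fun _ => rfl) (fun _ _ _ => rfl), add_sub_add_comm]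
        exact add_mem hx' hy'
      neg_mem' := by
        rintro a ⟨x, hx, hx'⟩
        refine ⟨-x, fun i => neg_mem (hx i), ?_⟩
        rw [Finsupp.sum_neg_index (fun _ => rfl), Finsupp.sum_neg, ← neg_sub']
        exact neg_mem hx' }
  have hlowD : filtration E deg d ≤ D := fun y hy => ⟨0, fun i => zero_mem _, by simpa using hy⟩
  have hlayer : ∀ (P : H1 S) (hP : deg P.gen = d + 1), layer E h P.prime_gen hP ≤ D := by
    intro P hP y hy
    refine ⟨Finsupp.single ⟨P, hP⟩ y, fun i => ?_, by simp [zero_mem]⟩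
    by_cases hi : i = ⟨P, hP⟩
    · subst hi; simpa using hy
    · rw [Finsupp.single_eq_of_ne hi]; exact zero_mem _
  have hlowneg : deg (-1 : S) ≤ d := by
    rw [show (-1 : S) = φ (-1) by simp, h.map]; omega
  have hgenlow : ∀ (P : H1 S), deg P.gen = d + 1 → ∀ y, y ≠ 0 → deg y ≤ d →
      rsymb E P.gen y ∈ D := fun P hP y hy0 hy =>
    hlayer P hP (rsymb_mem_layer E h P.prime_gen hP hy0 hy)
  have hgengen : ∀ P P' : H1 S, deg P.gen = d + 1 → deg P'.gen = d + 1 →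
      rsymb E P.gen P'.gen ∈ D := by
    intro P P' hP hP'
    by_cases hPP : P = P'
    · subst hPP
      rw [rsymb_self]
      exact hgenlow P hP _ (by simp) hlowneg
    obtain ⟨c, hc, s, r, hdiv, hr, hs⟩ := h.div P'.gen P.prime_gen.ne_zero
    have hφc := h.map_ne_zero hc
    have hr0 : r ≠ 0 := by
      rintro rfl
      rw [add_zero] at hdiv
      have : P.gen ∣ φ c * P'.gen := ⟨s, hdiv⟩
      rcases P.prime_gen.dvd_or_dvd this with h1 | h1
      · have := h.le_of_dvd hφc h1
        rw [h.map] at this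
        omega
      · exact H1.gen_notMem (Ne.symm hPP) ((H1.mem_iff_gen_dvd P).mpr h1)
    have hrd : deg r ≤ d := by
      have := hr.resolve_left hr0
      omega
    have hφd : deg (φ c) ≤ d := by rw [h.map]; omega
    have hs0 : s ≠ 0 := by
      rintro rfl
      rw [mul_zero, zero_add] at hdiv
      have := h.mul hφc P'.prime_gen.ne_zero
      rw [hdiv, h.map] at this
      omega
    have hsd : deg s ≤ d := by
      have := hs.resolve_left hs0
      omega
    have key := rsymb_of_add_eq E (mul_ne_zero P.prime_gen.ne_zero hs0) hr0
      (mul_ne_zero hφc P'.prime_gen.ne_zero) hdiv.symm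
    rw [rsymb_mul_left E P.prime_gen.ne_zero hs0, rsymb_mul_left E P.prime_gen.ne_zero hs0,
      rsymb_mul_right E P.gen hφc P'.prime_gen.ne_zero,
      rsymb_mul_right E s hφc P'.prime_gen.ne_zero,
      rsymb_mul_left E hφc P'.prime_gen.ne_zero,
      rsymb_mul_left E hφc P'.prime_gen.ne_zero, rsymb_anticomm E s P'.gen] at key
    have e : rsymb E P.gen P'.gen = rsymb E P.gen r + rsymb E s r - rsymb E P.gen (φ c)
        - rsymb E s (φ c) + rsymb E P'.gen s - rsymb E (φ c) r - rsymb E P'.gen r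
        + rsymb E (φ c) (-1) + rsymb E P'.gen (-1) := by
      linear_combination (norm := module) (-1 : ℤ) • key
    rw [e]
    exact add_mem (add_mem (sub_mem (sub_mem (add_mem (sub_mem (sub_mem (add_mem
      (hgenlow P hP r hr0 hrd) (hlowD (rsymb_mem_filtration E hsd hrd)))
      (hgenlow P hP _ hφc hφd)) (hlowD (rsymb_mem_filtration E hsd hφd)))
      (hgenlow P' hP' s hs0 hsd)) (hlowD (rsymb_mem_filtration E hφd hrd)))
      (hgenlow P' hP' r hr0 hrd)) (hlowD (rsymb_mem_filtration E hφd hlowneg)))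
      (hgenlow P' hP' _ (by simp) hlowneg)
  have hall : ∀ a b : S, a ≠ 0 → b ≠ 0 → deg a ≤ d + 1 → deg b ≤ d + 1 → rsymb E a b ∈ D := by
    intro a b ha hb had hbd
    refine mul_induction h (fun a => rsymb E a b ∈ D) ?_ ?_ ?_ a ha had
    · intro x y hx hy h1 h2
      rw [rsymb_mul_left E hx hy]
      exact add_mem h1 h2
    · intro a ha had
      refine mul_induction h (fun b => rsymb E a b ∈ D) ?_ ?_ ?_ b hb hbd
      · intro x y hx hy h1 h2
        rw [rsymb_mul_right E a hx hy]
        exact add_mem h1 h2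
      · exact fun b _ hb => hlowD (rsymb_mem_filtration E had hb)
      · intro P hP
        rw [rsymb_anticomm]
        exact neg_mem (hgenlow P hP a ha had)
    · intro P hP
      refine mul_induction h (fun b => rsymb E P.gen b ∈ D) ?_ ?_ ?_ b hb hbd
      · intro x y hx hy h1 h2
        rw [rsymb_mul_right E _ hx hy]
        exact add_mem h1 h2
      · exact fun b hb hbd => hgenlow P hP b hb hbd
      · exact fun P' hP' => hgengen P P' hP hP'
  suffices hD : filtration E deg (d + 1) ≤ D from hD hξ
  rw [filtration, AddSubgroup.closure_le]
  rintro _ ⟨a, b, ha, hb, rfl⟩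
  by_cases ha0 : a = 0
  · rw [ha0, rsymb_zero_left]; exact zero_mem _
  by_cases hb0 : b = 0
  · rw [hb0, rsymb_zero_right]; exact zero_mem _
  exact hall a b ha0 hb0 ha hb

end Decomposition

end MilnorK2

namespace GerstenData

open MilnorK2

section Horizontal

variable {R S : Type} [CommRing R] [CommRing S] [IsDomain R] [IsDomain S]
  [UniqueFactorizationMonoid S] [IsNoetherianRing S]
  {E : Type} [Field E] [Algebra S E] [IsFractionRing S E] {deg : S → ℕ}
  {φ : R →+* S} (h : IsPseudoDegree φ deg) [DecidableEq (H1 S)] (G : GerstenData S E)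
include h

omit [IsDomain R] [IsNoetherianRing S] [DecidableEq (H1 S)] in
theorem notMem_of_deg_lt {P : H1 S} {a : S} (ha : a ≠ 0) (had : deg a < deg P.gen) :
    a ∉ P.1.asIdeal := fun hmem => by
  have := h.le_of_dvd ha (P.mem_iff_gen_dvd.mp hmem)
  omega

omit [IsDomain R] [IsNoetherianRing S] [IsFractionRing S E] in
theorem tame_eq_zero_of_mem_filtration {d : ℕ} {ξ : MilnorK2 E} (hξ : ξ ∈ filtration E deg d)
    {P : H1 S} (hP : d < deg P.gen) : G.tame ξ P = 0 := by
  induction hξ using AddSubgroup.closure_induction with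
  | mem x hx =>
    obtain ⟨a, b, ha, hb, rfl⟩ := hx
    by_cases ha0 : a = 0
    · rw [ha0, rsymb_zero_left, map_zero]; rfl
    by_cases hb0 : b = 0
    · rw [hb0, rsymb_zero_right, map_zero]; rfl
    exact G.tame_unit P a b (notMem_of_deg_lt h ha0 (by omega))
      (notMem_of_deg_lt h hb0 (by omega))
  | zero => rw [map_zero]; rfl
  | add x y _ _ hx hy => rw [map_add, DirectSum.add_apply, hx, hy, add_zero]
  | neg x _ hx =>
    rw [map_neg]
    change -(G.tame x P) = 0
    rw [hx, neg_zero]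

omit [IsNoetherianRing S] in
theorem tame_eq_zero_of_mem_layer {d : ℕ} {P P' : H1 S} (hP : deg P.gen = d + 1)
    (hP' : d < deg P'.gen) (hne : P ≠ P') {ξ : MilnorK2 E}
    (hξ : ξ ∈ layer E h P.prime_gen hP) : G.tame ξ P' = 0 := by
  obtain ⟨g, g', hg0, hg0', hg, hg', hmem⟩ := hξ
  have h1 := tame_eq_zero_of_mem_filtration h G hmem hP'
  have h2 : ∀ g : S, g ≠ 0 → deg g ≤ d → G.tame (rsymb E P.gen g) P' = 0 := fun g hg0 hg =>
    G.tame_unit P' _ _ (H1.gen_notMem hne) (notMem_of_deg_lt h hg0 (by omega))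
  rw [map_sub, map_sub, DirectSum.sub_apply, DirectSum.sub_apply, h2 g hg0 hg,
    h2 g' hg0' hg', sub_zero, sub_zero] at h1
  exact h1

omit [IsNoetherianRing S] in
theorem mem_filtration_of_mem_layer {d : ℕ} {P : H1 S} (hP : deg P.gen = d + 1)
    {ξ : MilnorK2 E} (hξ : ξ ∈ layer E h P.prime_gen hP) (hξ0 : G.tame ξ P = 0) :
    ξ ∈ filtration E deg d := by
  obtain ⟨g, g', hg0, hg0', hg, hg', hmem⟩ := hξ
  have h1 := tame_eq_zero_of_mem_filtration h G hmem (P := P) (by omega)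
  have hgP := notMem_of_deg_lt h (P := P) hg0 (by omega)
  have hgP' := notMem_of_deg_lt h (P := P) hg0' (by omega)
  rw [map_sub, map_sub, DirectSum.sub_apply, DirectSum.sub_apply, hξ0, zero_sub, neg_eq_zero,
    G.tame_gen P _ P.eq_span_gen g hgP, G.tame_gen P _ P.eq_span_gen g' hgP', sub_eq_zero] at h1
  have h2 := (residUnit_eq_iff P.1 hgP hgP').mp (Additive.ofMul.injective h1)
  have h3 : g = g' := by
    by_contra hne
    have h4 := h.sub_le g g'
    exact notMem_of_deg_lt h (sub_ne_zero.mpr hne) (by omega) h2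
  rw [h3, sub_self, sub_zero] at hmem
  exact hmem

theorem mem_filtration_zero {d : ℕ} {ξ : MilnorK2 E} (hξ : ξ ∈ filtration E deg d)
    (hξ0 : ∀ P : H1 S, 0 < deg P.gen → G.tame ξ P = 0) : ξ ∈ filtration E deg 0 := by
  induction d with
  | zero => exact hξ
  | succ d ih =>
    apply ih
    obtain ⟨x, hx, hmem⟩ := exists_finsupp_of_mem_filtration E h hξ
    have hcomp : ∀ i, x i ∈ filtration E deg d := by
      intro i
      refine mem_filtration_of_mem_layer h G i.2 (hx i) ?_
      have h1 := tame_eq_zero_of_mem_filtration h G hmem (P := i.1) (by have := i.2; omega)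
      rw [map_sub, DirectSum.sub_apply, hξ0 i.1 (by have := i.2; omega), zero_sub, neg_eq_zero,
        Finsupp.sum, map_sum] at h1
      by_cases hi : i ∈ x.support
      · rw [DFinsupp.finsetSum_apply, Finset.sum_eq_single_of_mem i hi] at h1
        · exact h1
        · intro j _ hji
          exact tame_eq_zero_of_mem_layer h G j.2 (by have := i.2; omega)
            (fun he => hji (Subtype.ext he)) (hx j)
      · rw [Finsupp.notMem_support_iff.mp hi, map_zero]; rfl
    have h2 := add_mem hmem (AddSubgroup.sum_mem _ (fun i (_ : i ∈ x.support) => hcomp i))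
    rwa [Finsupp.sum, sub_add_cancel] at h2

/-- An element with trivial tame symbols at all points not coming from the base comes from the
base. -/
theorem exists_map_eq {F : Type} [Field F] [Algebra R F] (σ : F →+* E)
    (hσ : ∀ r, σ (algebraMap R F r) = algebraMap S E (φ r)) {ξ : MilnorK2 E}
    (hξ0 : ∀ P : H1 S, 0 < deg P.gen → G.tame ξ P = 0) : ∃ η, map σ η = ξ := by
  obtain ⟨d, hd⟩ := exists_mem_filtration E deg ξ
  exact filtration_zero_le E h σ hσ (mem_filtration_zero h G hd hξ0)

omit [IsDomain R] [IsNoetherianRing S] [IsFractionRing S E] in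
theorem exists_tame_eq_single {d : ℕ} {P : H1 S} (hP : deg P.gen = d + 1)
    (u : Additive (kappa P.1)ˣ) :
    ∃ ξ : MilnorK2 E, G.tame ξ P = u ∧ ∀ P', P' ≠ P → d < deg P'.gen → G.tame ξ P' = 0 := by
  have key : ∀ a : S, ∀ ha : a ∉ P.1.asIdeal, ∃ ξ : MilnorK2 E,
      G.tame ξ P = Additive.ofMul (residUnit P.1 a ha) ∧
        ∀ P', P' ≠ P → d < deg P'.gen → G.tame ξ P' = 0 := by
    intro a ha
    obtain ⟨c, hc, s, g, hdiv, hg, -⟩ := h.div a P.prime_gen.ne_zero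
    have hφc := h.map_ne_zero hc
    have hlow : ∀ P' : H1 S, d < deg P'.gen → φ c ∉ P'.1.asIdeal := fun P' hP' =>
      notMem_of_deg_lt h hφc (by rw [h.map]; omega)
    have hca : φ c * a ∉ P.1.asIdeal := fun hmem =>
      (P.1.isPrime.mem_or_mem hmem).elim (hlow P (by omega)) ha
    have hg0 : g ≠ 0 := by
      rintro rfl
      apply hca
      rw [hdiv, add_zero, H1.mem_iff_gen_dvd]
      exact dvd_mul_right _ _
    have hgd : deg g ≤ d := by
      have := hg.resolve_left hg0
      omega
    have hgP : ∀ P' : H1 S, d < deg P'.gen → g ∉ P'.1.asIdeal := fun P' hP' =>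
      notMem_of_deg_lt h hg0 (by omega)
    refine ⟨rsymb E P.gen g - rsymb E P.gen (φ c), ?_, fun P' hne hP' => ?_⟩
    · rw [map_sub, DirectSum.sub_apply, G.tame_gen P _ P.eq_span_gen g (hgP P (by omega)),
        G.tame_gen P _ P.eq_span_gen (φ c) (hlow P (by omega)), sub_eq_iff_eq_add, ← ofMul_mul,
        mul_comm, ← residUnit_mul P.1 _ _ hca]
      congr 1
      rw [residUnit_eq_iff, ← neg_mem_iff, hdiv, H1.mem_iff_gen_dvd]
      exact ⟨s, by ring⟩
    · rw [map_sub, DirectSum.sub_apply,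
        G.tame_unit P' _ _ (H1.gen_notMem hne.symm) (hgP P' hP'),
        G.tame_unit P' _ _ (H1.gen_notMem hne.symm) (hlow P' hP'), sub_zero]
  obtain ⟨a, b, ha, hb, hu⟩ := exists_residUnit_div P.1 u.toMul
  obtain ⟨ξ, h1, h2⟩ := key a ha
  obtain ⟨ξ', h1', h2'⟩ := key b hb
  refine ⟨ξ - ξ', ?_, fun P' hne hP' => ?_⟩
  · rw [map_sub, DirectSum.sub_apply, h1, h1', ← ofMul_div, ← hu]
    rfl
  · rw [map_sub, DirectSum.sub_apply, h2 P' hne hP', h2' P' hne hP', sub_zero]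

omit [IsDomain R] [IsNoetherianRing S] [IsFractionRing S E] in
theorem exists_tame_eq_degree (d : ℕ) (α : DirectSum (H1 S) (fun p => Additive (kappa p.1)ˣ)) :
    ∃ ξ : MilnorK2 E, (∀ P : H1 S, deg P.gen = d + 1 → G.tame ξ P = α P) ∧
      ∀ P : H1 S, d + 1 < deg P.gen → G.tame ξ P = 0 := by
  induction α using DirectSum.induction_on with
  | zero => exact ⟨0, fun P _ => by rw [map_zero], fun P _ => by rw [map_zero]; rfl⟩
  | of P u =>
    by_cases hP : deg P.gen = d + 1
    · obtain ⟨ξ, h1, h2⟩ := exists_tame_eq_single h G hP u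
      refine ⟨ξ, fun P' hP' => ?_, fun P' hP' => h2 P' (by rintro rfl; omega) (by omega)⟩
      by_cases hne : P' = P
      · subst hne
        rw [h1, DirectSum.of_eq_same]
      · rw [h2 P' hne (by omega), DirectSum.of_eq_of_ne _ _ _ hne]
    · refine ⟨0, fun P' hP' => ?_, fun P' _ => by rw [map_zero]; rfl⟩
      rw [map_zero, DirectSum.of_eq_of_ne _ _ _ (by rintro rfl; exact hP hP')]
      rfl
  | add α β hα hβ =>
    obtain ⟨ξ, h1, h2⟩ := hα
    obtain ⟨ξ', h1', h2'⟩ := hβ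
    refine ⟨ξ + ξ', fun P hP => ?_, fun P hP => ?_⟩
    · rw [map_add, DirectSum.add_apply, DirectSum.add_apply, h1 P hP, h1' P hP]
    · rw [map_add, DirectSum.add_apply, h2 P hP, h2' P hP, add_zero]

omit [IsDomain R] [IsNoetherianRing S] [IsFractionRing S E] in
/-- Every family of units is the family of tame symbols of an element of `K₂` at the points not
coming from the base. -/
theorem exists_tame_eq (α : DirectSum (H1 S) (fun p => Additive (kappa p.1)ˣ)) :
    ∃ ξ : MilnorK2 E, ∀ P : H1 S, 0 < deg P.gen → G.tame ξ P = α P := by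
  have hbound : ∃ N, ∀ P : H1 S, N < deg P.gen → α P = 0 := by
    induction α using DirectSum.induction_on with
    | zero => exact ⟨0, fun P _ => rfl⟩
    | of P u =>
      exact ⟨deg P.gen, fun P' hP' => DirectSum.of_eq_of_ne _ _ _ (by rintro rfl; omega)⟩
    | add α β hα hβ =>
      obtain ⟨N, hN⟩ := hα
      obtain ⟨N', hN'⟩ := hβ
      refine ⟨max N N', fun P hP => ?_⟩
      rw [DirectSum.add_apply, hN P (by omega), hN' P (by omega), add_zero]
  obtain ⟨N, hN⟩ := hbound
  induction N generalizing α with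
  | zero => exact ⟨0, fun P hP => by rw [map_zero, hN P hP]; rfl⟩
  | succ N ih =>
    obtain ⟨ξ, h1, h2⟩ := exists_tame_eq_degree h G N α
    obtain ⟨ξ', h'⟩ := ih (α - G.tame ξ) fun P hP => by
      rw [DirectSum.sub_apply]
      by_cases hd : deg P.gen = N + 1
      · rw [h1 P hd, sub_self]
      · rw [h2 P (by omega), hN P (by omega), sub_zero]
    refine ⟨ξ' + ξ, fun P hP => ?_⟩
    rw [map_add, DirectSum.add_apply, h' P hP, DirectSum.sub_apply, sub_add_cancel]

end Horizontal

end GerstenData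

section Length

variable {S : Type} [CommRing S] (Q : Ideal S) [Q.IsPrime] (I : Ideal S)

theorem localLength_eq_zero (h : ¬ I ≤ Q) : localLength Q I = 0 := by
  rw [localLength, Module.length_eq_zero_iff, Ideal.Quotient.subsingleton_iff]
  exact IsLocalization.AtPrime.map_eq_top_of_not_le _ h

theorem localLength_ne_zero (h : I ≤ Q) : localLength Q I ≠ 0 := by
  rw [localLength, Ne, Module.length_eq_zero_iff, Ideal.Quotient.subsingleton_iff]
  intro htop
  have h1 := Ideal.map_mono (f := algebraMap S (Localization.AtPrime Q)) h
  rw [htop, Localization.AtPrime.map_eq_maximalIdeal, top_le_iff] at h1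
  exact (IsLocalRing.maximalIdeal.isMaximal _).ne_top h1

theorem localLength_ne_top_of_mem_minimalPrimes [IsNoetherianRing S] (h : Q ∈ I.minimalPrimes) :
    localLength Q I ≠ ⊤ := by
  have hmin : IsLocalRing.maximalIdeal (Localization.AtPrime Q) ∈
      (I.map (algebraMap S (Localization.AtPrime Q))).minimalPrimes := by
    refine ⟨⟨inferInstance, ?_⟩, fun J ⟨hJ, hIJ⟩ _ => ?_⟩
    · rw [← Localization.AtPrime.map_eq_maximalIdeal]
      exact Ideal.map_mono h.1.2
    · have h1 : J.under S ≤ Q := by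
        have := Ideal.comap_mono (f := algebraMap S (Localization.AtPrime Q))
          (IsLocalRing.le_maximalIdeal hJ.ne_top)
        exact this.trans Localization.AtPrime.under_maximalIdeal.le
      have h2 : J.under S = Q :=
        le_antisymm h1 (h.2 ⟨inferInstance, Ideal.map_le_iff_le_comap.mp hIJ⟩ h1)
      exact (Localization.AtPrime.eq_maximalIdeal_iff_under_eq.mp h2).ge
  have := IsLocalRing.quotient_artinian_of_mem_minimalPrimes_of_isLocalRing _ hmin
  rw [localLength]
  have := isArtinian_of_surjective_algebraMap (S := Localization.AtPrime Q)
    (M := Localization.AtPrime Q ⧸ I.map (algebraMap S (Localization.AtPrime Q)))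
    (R := Localization.AtPrime Q ⧸ I.map (algebraMap S (Localization.AtPrime Q)))
    Ideal.Quotient.mk_surjective
  exact Module.length_ne_top

end Length

theorem H2.mem_minimalPrimes {S : Type} [CommRing S] (Q : H2 S) (P : H1 S) {a : S}
    (ha : a ∉ P.1.asIdeal) (h : P.1.asIdeal ⊔ Ideal.span {a} ≤ Q.1.asIdeal) :
    Q.1.asIdeal ∈ (P.1.asIdeal ⊔ Ideal.span {a}).minimalPrimes := by
  refine ⟨⟨Q.1.isPrime, h⟩, fun J ⟨hJ, hPJ⟩ hJQ => ?_⟩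
  by_contra hne
  have hlt : J < Q.1.asIdeal := lt_of_le_not_ge hJQ hne
  have : Q.1.asIdeal.FiniteHeight := ⟨Or.inr (by rw [Q.height]; exact ENat.ofNat_ne_top 2)⟩
  have hJfin : J.FiniteHeight := ⟨Or.inr ((Ideal.height_mono hJQ).trans_lt (by
    rw [Q.height]; exact ENat.natCast_lt_top 2)).ne⟩
  have h1 := Ideal.height_strict_mono_of_isPrime hlt
  rw [Q.height] at h1
  have h2 : J.height ≤ 1 := Order.le_of_lt_add_one (by rw [one_add_one_eq_two]; exact h1)
  have : P.1.asIdeal.FiniteHeight := ⟨Or.inr (by rw [P.height]; simp)⟩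
  have h3 := Ideal.eq_of_le_of_height_le _ (le_sup_left.trans hPJ) (by rwa [P.height])
  apply ha
  rw [h3]
  exact hPJ (Ideal.mem_sup_right (Ideal.mem_span_singleton_self a))

theorem localLength_ne_top {S : Type} [CommRing S] [IsNoetherianRing S] (Q : H2 S) (P : H1 S)
    {a : S} (ha : a ∉ P.1.asIdeal) :
    localLength Q.1.asIdeal (P.1.asIdeal ⊔ Ideal.span {a}) ≠ ⊤ := by
  by_cases h : P.1.asIdeal ⊔ Ideal.span {a} ≤ Q.1.asIdeal
  · exact localLength_ne_top_of_mem_minimalPrimes _ _ (Q.mem_minimalPrimes P ha h)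
  · rw [localLength_eq_zero _ _ h]
    exact ENat.zero_ne_top

namespace GerstenData

open MilnorK2

variable {S : Type} [CommRing S] [IsDomain S]
  {E : Type} [Field E] [Algebra S E] [DecidableEq (H1 S)] (G : GerstenData S E)

theorem dv_residUnit [IsNoetherianRing S] (P : H1 S) (a : S) (ha : a ∉ P.1.asIdeal) (Q : H2 S) :
    G.dv (DirectSum.of (fun p : H1 S => Additive (kappa p.1)ˣ) P
      (Additive.ofMul (residUnit P.1 a ha))) Q =
      (localLength Q.1.asIdeal (P.1.asIdeal ⊔ Ideal.span {a})).toNat :=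
  G.dv_of P a ha Q _ (ENat.natCast_toNat (localLength_ne_top Q P ha)).symm

theorem dv_residUnit_eq_zero (P : H1 S) (a : S) (ha : a ∉ P.1.asIdeal) (Q : H2 S)
    (h : ¬ P.1.asIdeal ⊔ Ideal.span {a} ≤ Q.1.asIdeal) :
    G.dv (DirectSum.of (fun p : H1 S => Additive (kappa p.1)ˣ) P
      (Additive.ofMul (residUnit P.1 a ha))) Q = 0 :=
  G.dv_of P a ha Q 0 (by rw [localLength_eq_zero _ _ h]; rfl)

theorem dv_residUnit_pos [IsNoetherianRing S] (P : H1 S) (a : S) (ha : a ∉ P.1.asIdeal) (Q : H2 S)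
    (h : P.1.asIdeal ⊔ Ideal.span {a} ≤ Q.1.asIdeal) :
    0 < G.dv (DirectSum.of (fun p : H1 S => Additive (kappa p.1)ˣ) P
      (Additive.ofMul (residUnit P.1 a ha))) Q := by
  rw [dv_residUnit]
  have h1 := localLength_ne_top Q P ha
  have h2 := localLength_ne_zero _ _ h
  have := (ENat.toNat_eq_zero (n := localLength Q.1.asIdeal (P.1.asIdeal ⊔ Ideal.span {a}))).not.mpr
    (by tauto)
  omega

theorem tame_rsymb_units {a b : S} (ha : IsUnit a) (hb : IsUnit b) :
    G.tame (rsymb E a b) = 0 := by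
  have h : ∀ {a : S} (P : H1 S), IsUnit a → a ∉ P.1.asIdeal := fun P ha hmem =>
    P.1.isPrime.ne_top (Ideal.eq_top_of_isUnit_mem _ hmem ha)
  ext1 P
  exact G.tame_unit P a b (h P ha) (h P hb)

theorem tame_rsymb_gen_unit [UniqueFactorizationMonoid S] (P : H1 S) {b : S} (hb : IsUnit b)
    (h : b ∉ P.1.asIdeal) :
    G.tame (rsymb E P.gen b) = DirectSum.of (fun p : H1 S => Additive (kappa p.1)ˣ) P
      (Additive.ofMul (residUnit P.1 b h)) := by
  ext1 P'
  by_cases hP : P' = P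
  · subst hP
    rw [DirectSum.of_eq_same, G.tame_gen P' _ P'.eq_span_gen b h]
  · rw [DirectSum.of_eq_of_ne _ _ _ hP]
    exact G.tame_unit P' _ _ (H1.gen_notMem (Ne.symm hP))
      (fun hmem => P'.1.isPrime.ne_top (Ideal.eq_top_of_isUnit_mem _ hmem hb))

theorem tame_rsymb_gen_gen [UniqueFactorizationMonoid S] {P P' : H1 S} (hne : P ≠ P') :
    G.tame (rsymb E P.gen P'.gen) =
      DirectSum.of (fun p : H1 S => Additive (kappa p.1)ˣ) P
        (Additive.ofMul (residUnit P.1 P'.gen (H1.gen_notMem hne.symm))) -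
      DirectSum.of (fun p : H1 S => Additive (kappa p.1)ˣ) P'
        (Additive.ofMul (residUnit P'.1 P.gen (H1.gen_notMem hne))) := by
  ext1 P''
  rw [DirectSum.sub_apply]
  by_cases hP : P'' = P
  · subst hP
    rw [DirectSum.of_eq_same, DirectSum.of_eq_of_ne _ _ _ hne, sub_zero,
      G.tame_gen P'' _ P''.eq_span_gen]
  by_cases hP' : P'' = P'
  · subst hP'
    rw [DirectSum.of_eq_same, DirectSum.of_eq_of_ne _ _ _ hP, zero_sub,
      rsymb_anticomm, map_neg, ← G.tame_gen P'' _ P''.eq_span_gen]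
    rfl
  · rw [DirectSum.of_eq_of_ne _ _ _ hP, DirectSum.of_eq_of_ne _ _ _ hP', sub_zero]
    exact G.tame_unit P'' _ _ (H1.gen_notMem (Ne.symm hP)) (H1.gen_notMem (Ne.symm hP'))

theorem dv_tame [UniqueFactorizationMonoid S] [IsNoetherianRing S] [IsFractionRing S E]
    (ξ : MilnorK2 E) : G.dv (G.tame ξ) = 0 := by
  let D : AddSubgroup (MilnorK2 E) := (G.dv.comp G.tame).ker
  have hu : ∀ P : H1 S, ∀ b : S, IsUnit b → rsymb E P.gen b ∈ D := by
    intro P b hb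
    have h : b ∉ P.1.asIdeal := fun hmem =>
      P.1.isPrime.ne_top (Ideal.eq_top_of_isUnit_mem _ hmem hb)
    change G.dv (G.tame _) = 0
    rw [tame_rsymb_gen_unit G P hb h]
    ext Q
    refine G.dv_residUnit_eq_zero P b h Q fun hle => Q.1.isPrime.ne_top
      (Ideal.eq_top_of_isUnit_mem _
        (hle (Ideal.mem_sup_right (Ideal.mem_span_singleton_self b))) hb)
  have hg : ∀ P P' : H1 S, rsymb E P.gen P'.gen ∈ D := by
    intro P P'
    by_cases hne : P = P'
    · subst hne
      rw [rsymb_self]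
      exact hu P _ isUnit_one.neg
    · change G.dv (G.tame _) = 0
      rw [tame_rsymb_gen_gen G hne, map_sub]
      ext Q
      rw [Finsupp.sub_apply, dv_residUnit, dv_residUnit, P.eq_span_gen, P'.eq_span_gen, sup_comm,
        sub_self]
      rfl
  have hind : ∀ C : S → Prop, (∀ a b, a ≠ 0 → b ≠ 0 → C a → C b → C (a * b)) →
      (∀ a, IsUnit a → C a) → (∀ P : H1 S, C P.gen) → ∀ a, a ≠ 0 → C a := by
    intro C hmul hunit hgen a ha
    induction a using UniqueFactorizationMonoid.induction_on_prime with
    | h₁ => exact (ha rfl).elim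
    | h₂ x hx => exact hunit x hx
    | h₃ a p ha0 hp ih =>
      refine hmul _ _ hp.ne_zero ha0 ?_ (ih ha0)
      have hass : Associated (H1.ofPrime hp).gen p := by
        rw [← Ideal.span_singleton_eq_span_singleton, ← H1.eq_span_gen, H1.ofPrime_asIdeal]
      obtain ⟨u, hu⟩ := hass
      rw [← hu]
      exact hmul _ _ (H1.prime_gen _).ne_zero u.ne_zero (hgen _) (hunit _ u.isUnit)
  have hξ : ξ ∈ AddSubgroup.closure
      {ξ : MilnorK2 E | ∃ a b : S, a ≠ 0 ∧ b ≠ 0 ∧ ξ = rsymb E a b} := by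
    rw [closure_rsymb]; trivial
  suffices h : AddSubgroup.closure
      {ξ : MilnorK2 E | ∃ a b : S, a ≠ 0 ∧ b ≠ 0 ∧ ξ = rsymb E a b} ≤ D from h hξ
  rw [AddSubgroup.closure_le]
  rintro _ ⟨a, b, ha, hb, rfl⟩
  refine hind (fun a => rsymb E a b ∈ D) (fun x y hx hy h1 h2 => ?_) (fun a ha => ?_)
    (fun P => ?_) a ha
  · rw [rsymb_mul_left E hx hy]
    exact add_mem h1 h2
  · refine hind (fun b => rsymb E a b ∈ D) (fun x y hx hy h1 h2 => ?_) (fun b hb => ?_)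
      (fun P => ?_) b hb
    · rw [rsymb_mul_right E _ hx hy]
      exact add_mem h1 h2
    · change G.dv (G.tame _) = 0
      rw [tame_rsymb_units G ha hb, map_zero]
    · rw [rsymb_anticomm]
      exact neg_mem (hu P a ha)
  · refine hind (fun b => rsymb E P.gen b ∈ D) (fun x y hx hy h1 h2 => ?_) (fun b hb => hu P b hb)
      (fun P' => hg P P') b hb
    rw [rsymb_mul_right E _ hx hy]
    exact add_mem h1 h2

end GerstenData

theorem IsPseudoDegree.eq_of_le {A B : Type} [CommRing A] [CommRing B] [IsDomain A]
    [IsDomain B] {φ : A →+* B} {deg : B → ℕ} (h : IsPseudoDegree φ deg)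
    {P Q : Ideal B} [hP : P.IsPrime] [hQ : Q.IsPrime]
    (hbot : P ≠ ⊥) (hle : P ≤ Q) (hQ0 : Q.comap φ = ⊥) : P = Q := by
  have hnot : ∀ c, c ≠ 0 → φ c ∉ Q := fun c hc hmem => hc (by
    have : c ∈ Q.comap φ := hmem
    rwa [hQ0] at this)
  obtain ⟨g, hg, hg0, hgen⟩ := h.exists_generator (I := Q)
    (fun hb => hbot (le_bot_iff.mp (hb ▸ hle)))
  obtain ⟨k, hk, hk0, hgenk⟩ := h.exists_generator hbot
  have hgP : g ∈ P := by
    obtain ⟨c, hc, s, hs⟩ := hgen k (hle hk)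
    have hmem : g * s ∈ P := hs ▸ P.mul_mem_left _ hk
    refine (hP.mem_or_mem hmem).resolve_right fun hsP => ?_
    obtain ⟨c', hc', s', hs'⟩ := hgenk s hsP
    have h1 : k * (φ c' * φ c - g * s') = 0 := by
      linear_combination φ c' * hs + g * hs'
    have hk1 : φ c' * φ c = g * s' :=
      sub_eq_zero.mp ((mul_eq_zero.mp h1).resolve_left hk0)
    exact (hQ.mem_or_mem (show φ c' * φ c ∈ Q from hk1 ▸ Q.mul_mem_right _ hg)).elim
      (hnot _ hc') (hnot _ hc)
  refine le_antisymm hle fun a ha => ?_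
  obtain ⟨c, hc, s, hs⟩ := hgen a ha
  exact (hP.mem_or_mem (show φ c * a ∈ P from hs ▸ P.mul_mem_right _ hgP)).resolve_left
    fun hmem => hnot c hc (hle hmem)

/-- `S` is a polynomial ring in one variable over `R`. -/
class IsPolynomialExtension (R S : Type) [CommRing R] [CommRing S] [Algebra R S] : Prop where
  exists_equiv : Nonempty (Polynomial R ≃ₐ[R] S)

section Extension

variable (R S : Type) [CommRing R] [CommRing S] [Algebra R S] [IsPolynomialExtension R S]

theorem IsPolynomialExtension.free : Module.Free R S :=
  let ⟨e⟩ := IsPolynomialExtension.exists_equiv (R := R) (S := S)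
  Module.Free.of_equiv e.toLinearEquiv

theorem IsPolynomialExtension.exists_pseudoDegree [IsDomain R] :
    ∃ deg, IsPseudoDegree (algebraMap R S) deg :=
  let ⟨e⟩ := IsPolynomialExtension.exists_equiv (R := R) (S := S)
  ⟨_, IsPseudoDegree.of_equiv _ e.toRingEquiv e.commutes⟩

instance [IsDomain R] : Module.FaithfullyFlat R S :=
  have := IsPolynomialExtension.free R S
  have : Nontrivial S :=
    (IsPolynomialExtension.exists_pseudoDegree R S).choose_spec.injective.nontrivial
  inferInstance

variable {R}

instance Ideal.map_isPrime_of_isPolynomialExtension (p : Ideal R) [p.IsPrime] :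
    (p.map (algebraMap R S)).IsPrime := by
  obtain ⟨e⟩ := IsPolynomialExtension.exists_equiv (R := R) (S := S)
  have : p.map (algebraMap R S) = (p.map Polynomial.C).map
      (e.toRingEquiv : Polynomial R →+* S) := by
    rw [Ideal.map_map]
    congr 1
    ext r
    exact (e.commutes r).symm
  rw [this]
  have := Ideal.isPrime_map_C_of_isPrime (P := p)
  exact Ideal.map_isPrime_of_equiv e.toRingEquiv

/-- The map of residue rings induced by a ring extension. -/
noncomputable def fiberMap (p : Ideal R) : R ⧸ p →+* S ⧸ p.map (algebraMap R S) :=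
  Ideal.quotientMap _ (algebraMap R S) Ideal.le_comap_map

omit [IsPolynomialExtension R S] in
theorem fiberMap_mk (p : Ideal R) (r : R) :
    fiberMap S p (Ideal.Quotient.mk p r) = Ideal.Quotient.mk _ (algebraMap R S r) := rfl

theorem exists_pseudoDegree_fiberMap (p : Ideal R) [p.IsPrime] :
    ∃ deg, IsPseudoDegree (fiberMap S p) deg := by
  obtain ⟨e⟩ := IsPolynomialExtension.exists_equiv (R := R) (S := S)
  have h : p.map (algebraMap R S) = (p.map Polynomial.C).map
      (e.toRingEquiv : Polynomial R →+* S) := by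
    rw [Ideal.map_map]
    congr 1
    ext r
    exact (e.commutes r).symm
  let e' := (Ideal.polynomialQuotientEquivQuotientPolynomial p).trans
    (Ideal.quotientEquiv (p.map Polynomial.C) (p.map (algebraMap R S)) e.toRingEquiv h)
  refine ⟨_, IsPseudoDegree.of_equiv _ e' fun c => ?_⟩
  obtain ⟨r, rfl⟩ := Ideal.Quotient.mk_surjective c
  rw [fiberMap_mk]
  have h1 : Polynomial.C (Ideal.Quotient.mk p r) = (Polynomial.C r).map (Ideal.Quotient.mk p) := by
    rw [Polynomial.map_C]
  change Ideal.quotientEquiv _ _ e.toRingEquiv h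
    (Ideal.polynomialQuotientEquivQuotientPolynomial p _) = _
  rw [h1, Ideal.polynomialQuotientEquivQuotientPolynomial_map_mk]
  change Ideal.Quotient.mk _ (e (Polynomial.C r)) = _
  congr 1
  exact e.commutes r

variable [IsDomain R]

theorem Ideal.under_map_of_isPolynomialExtension (p : Ideal R) :
    (p.map (algebraMap R S)).under R = p :=
  p.comap_map_eq_self_of_faithfullyFlat

variable {S}

omit [IsPolynomialExtension R S] [IsDomain R] in
theorem comap_fiberMap_eq_bot {p : Ideal R} {Q : Ideal S} (hp : Q.under R = p) :
    (Q.map (Ideal.Quotient.mk (p.map (algebraMap R S)))).comap (fiberMap S p) = ⊥ := by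
  rw [eq_bot_iff]
  intro x hx
  obtain ⟨r, rfl⟩ := Ideal.Quotient.mk_surjective x
  rw [Ideal.mem_comap, fiberMap_mk, Ideal.mem_quotient_iff_mem] at hx
  · rw [Ideal.mem_bot, Ideal.Quotient.eq_zero_iff_mem, ← hp]
    exact hx
  · rw [← hp]; exact Ideal.map_comap_le

variable [IsNoetherianRing R] [IsNoetherianRing S]

theorem Ideal.height_of_under_eq {Q : Ideal S} [Q.IsPrime] {p : Ideal R} [p.IsPrime]
    (hp : Q.under R = p) :
    (Q = p.map (algebraMap R S) ∧ Q.height = p.height) ∨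
      (Q ≠ p.map (algebraMap R S) ∧ Q.height = p.height + 1) := by
  have hle : p.map (algebraMap R S) ≤ Q := by rw [← hp]; exact Ideal.map_comap_le
  have : Q.LiesOver p := ⟨hp.symm⟩
  have hker : RingHom.ker (Ideal.Quotient.mk (p.map (algebraMap R S))) ≤ Q := by
    rwa [Ideal.mk_ker]
  have hprime : (Q.map (Ideal.Quotient.mk (p.map (algebraMap R S)))).IsPrime :=
    Ideal.map_isPrime_of_surjective Ideal.Quotient.mk_surjective hker
  rw [Ideal.height_eq_height_add_of_liesOver_of_hasGoingDown p Q]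
  by_cases hQ : Q = p.map (algebraMap R S)
  · refine Or.inl ⟨hQ, ?_⟩
    have : Q.map (Ideal.Quotient.mk (p.map (algebraMap R S))) = ⊥ := by
      conv_lhs => rw [hQ]
      exact Ideal.map_quotient_self _
    rw [this, Ideal.height_bot, add_zero]
  · refine Or.inr ⟨hQ, ?_⟩
    congr 1
    have hne : Q.map (Ideal.Quotient.mk (p.map (algebraMap R S))) ≠ ⊥ := by
      rw [Ne, Ideal.map_eq_bot_iff_le_ker, Ideal.mk_ker]
      exact fun h => hQ (le_antisymm h hle)
    obtain ⟨deg, hdeg⟩ := exists_pseudoDegree_fiberMap S p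
    apply le_antisymm
    · have : ((1 : ℕ) : ℕ∞) = 1 := rfl
      rw [← this, Ideal.height_le_iff]
      intro q hq hlt
      have hq0 : q = ⊥ := by
        by_contra hq0
        exact hlt.ne (hdeg.eq_of_le hq0 hlt.le (comap_fiberMap_eq_bot hp))
      rw [hq0, Ideal.height_bot]
      exact zero_lt_one
    · rw [Order.one_le_iff_ne_zero, Ne, Ideal.height_eq_zero_iff_eq_bot]
      exact hne

theorem Ideal.height_map_of_isPolynomialExtension (p : Ideal R) [p.IsPrime] :
    (p.map (algebraMap R S)).height = p.height :=
  (Ideal.height_of_under_eq (Ideal.under_map_of_isPolynomialExtension S p)).elim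
    (fun h => h.2) (fun h => (h.1 rfl).elim)

end Extension

section Extend

variable {R : Type} (S : Type) [CommRing R] [CommRing S] [Algebra R S] [IsPolynomialExtension R S]
  [IsDomain R] [IsNoetherianRing R] [IsNoetherianRing S]

/-- The height-one prime generated by a height-one prime of the base. -/
noncomputable def H1.extend (p : H1 R) : H1 S :=
  H1.mk (p.1.asIdeal.map (algebraMap R S))
    (by rw [Ideal.height_map_of_isPolynomialExtension, p.height])

/-- The height-two prime generated by a height-two prime of the base. -/
noncomputable def H2.extend (q : H2 R) : H2 S :=
  H2.mk (q.1.asIdeal.map (algebraMap R S))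
    (by rw [Ideal.height_map_of_isPolynomialExtension, q.height])

theorem H1.extend_asIdeal (p : H1 R) :
    (p.extend S).1.asIdeal = p.1.asIdeal.map (algebraMap R S) := rfl

theorem H2.extend_asIdeal (q : H2 R) :
    (q.extend S).1.asIdeal = q.1.asIdeal.map (algebraMap R S) := rfl

theorem H1.under_extend (p : H1 R) : (p.extend S).1.asIdeal.under R = p.1.asIdeal :=
  Ideal.under_map_of_isPolynomialExtension S _

theorem H2.under_extend (q : H2 R) : (q.extend S).1.asIdeal.under R = q.1.asIdeal :=
  Ideal.under_map_of_isPolynomialExtension S _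

theorem H1.extend_injective : Function.Injective (H1.extend (R := R) S) := fun p q h =>
  H1.ext_ideal (by rw [← p.under_extend S, ← q.under_extend S, h])

theorem H2.extend_injective : Function.Injective (H2.extend (R := R) S) := fun p q h =>
  H2.ext_ideal (by rw [← p.under_extend S, ← q.under_extend S, h])

theorem H1.algebraMap_mem_extend_iff (p : H1 R) {a : R} :
    algebraMap R S a ∈ (p.extend S).1.asIdeal ↔ a ∈ p.1.asIdeal :=
  SetLike.ext_iff.mp (p.under_extend S) a

variable {S}

theorem H1.exists_extend_eq (P : H1 S) (h : P.1.asIdeal.under R ≠ ⊥) :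
    ∃ p : H1 R, p.extend S = P := by
  have hP := P.1.isPrime
  have h1 := P.height
  have hne : (P.1.asIdeal.under R).height ≠ 0 := by rwa [Ne, Ideal.height_eq_zero_iff_eq_bot]
  rcases Ideal.height_of_under_eq (R := R) (Q := P.1.asIdeal) rfl with ⟨h2, h3⟩ | ⟨h2, h3⟩
  · exact ⟨H1.mk (P.1.asIdeal.under R) (by rw [← h3, h1]), H1.ext_ideal h2.symm⟩
  · rw [h1] at h3
    refine (hne ?_).elim
    have : (0 : ℕ∞) + 1 = (P.1.asIdeal.under R).height + 1 := by rw [← h3, zero_add]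
    exact (ENat.add_left_injective_of_ne_top ENat.one_ne_top this).symm

theorem H2.exists_extend_eq (Q : H2 S) : (∃ q : H2 R, q.extend S = Q) ∨
    ∃ p : H1 R, Q.1.asIdeal.under R = p.1.asIdeal := by
  have hQ := Q.1.isPrime
  have h1 := Q.height
  rcases Ideal.height_of_under_eq (R := R) (Q := Q.1.asIdeal) rfl with ⟨h2, h3⟩ | ⟨h2, h3⟩
  · exact Or.inl ⟨H2.mk (Q.1.asIdeal.under R) (by rw [← h3, h1]), H2.ext_ideal h2.symm⟩
  · refine Or.inr ⟨H1.mk (Q.1.asIdeal.under R) ?_, rfl⟩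
    rw [h1] at h3
    have : (1 : ℕ∞) + 1 = (Q.1.asIdeal.under R).height + 1 := by rw [← h3, one_add_one_eq_two]
    exact (ENat.add_left_injective_of_ne_top ENat.one_ne_top this).symm

theorem H2.extend_ne_of_under_eq {Q : H2 S} {p : H1 R} (h : Q.1.asIdeal.under R = p.1.asIdeal)
    (q : H2 R) : q.extend S ≠ Q := by
  rintro rfl
  have h1 := q.height
  rw [← q.under_extend S, h, p.height] at h1
  norm_num at h1

/-- A prime lying over a height-one prime and different from its extension has height two. -/
theorem H2.exists_of_under_eq {Q : Ideal S} [Q.IsPrime] {p : H1 R}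
    (h : Q.under R = p.1.asIdeal) (hne : Q ≠ p.1.asIdeal.map (algebraMap R S)) :
    ∃ Q' : H2 S, Q'.1.asIdeal = Q := by
  refine ⟨H2.mk Q ?_, rfl⟩
  rcases Ideal.height_of_under_eq h with ⟨h2, -⟩ | ⟨-, h3⟩
  · exact (hne h2).elim
  · rw [h3, p.height, one_add_one_eq_two]

theorem H1.extend_le_iff (p : H1 R) (I : Ideal S) :
    (p.extend S).1.asIdeal ≤ I ↔ p.1.asIdeal ≤ I.under R :=
  Ideal.map_le_iff_le_comap

section Degree

variable [UniqueFactorizationMonoid S] {deg : S → ℕ} [IsDomain S]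

theorem H1.exists_extend_eq_of_deg (h : IsPseudoDegree (algebraMap R S) deg) (P : H1 S)
    (hP : deg P.gen = 0) : ∃ p : H1 R, p.extend S = P := by
  obtain ⟨c, hc⟩ := h.eq_map hP
  refine P.exists_extend_eq fun hbot => ?_
  have hmem : c ∈ P.1.asIdeal.under R := by
    change algebraMap R S c ∈ P.1.asIdeal
    rw [hc, P.mem_iff_gen_dvd]
  rw [hbot, Ideal.mem_bot] at hmem
  exact P.prime_gen.ne_zero (by rw [← hc, hmem, map_zero])

end Degree

variable (S)

/-- The inclusion of residue fields at a height-one prime and its extension. -/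
noncomputable def kappaMap (p : H1 R) : kappa p.1 →+* kappa (p.extend S).1 :=
  IsFractionRing.lift (K := kappa p.1)
    (g := (algebraMap (S ⧸ (p.extend S).1.asIdeal) (kappa (p.extend S).1)).comp
      (fiberMap S p.1.asIdeal))
    ((IsFractionRing.injective (S ⧸ (p.extend S).1.asIdeal) (kappa (p.extend S).1)).comp
      (exists_pseudoDegree_fiberMap S p.1.asIdeal).choose_spec.injective)

theorem kappaMap_resid (p : H1 R) (a : R) :
    kappaMap S p (resid p.1 a) = resid (p.extend S).1 (algebraMap R S a) :=
  IsFractionRing.lift_algebraMap _ _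

/-- The inclusion of unit groups of residue fields at a height-one prime and its extension. -/
noncomputable def kappaUnitsMap (p : H1 R) :
    Additive (kappa p.1)ˣ →+ Additive (kappa (p.extend S).1)ˣ :=
  (Units.map (kappaMap S p).toMonoidHom).toAdditive

theorem kappaUnitsMap_residUnit (p : H1 R) (a : R) (ha : a ∉ p.1.asIdeal)
    (ha' : algebraMap R S a ∉ (p.extend S).1.asIdeal) :
    kappaUnitsMap S p (Additive.ofMul (residUnit p.1 a ha)) =
      Additive.ofMul (residUnit (p.extend S).1 (algebraMap R S a) ha') :=
  congrArg Additive.ofMul (Units.ext (kappaMap_resid S p a))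

theorem kappaUnitsMap_injective (p : H1 R) : Function.Injective (kappaUnitsMap S p) :=
  Units.map_injective (kappaMap S p).injective

variable [DecidableEq (H1 R)] [DecidableEq (H1 S)]

/-- The inclusion of direct sums of residue fields induced by extension of primes. -/
noncomputable def extendSum : DirectSum (H1 R) (fun p => Additive (kappa p.1)ˣ) →+
    DirectSum (H1 S) (fun p => Additive (kappa p.1)ˣ) :=
  DirectSum.toAddMonoid fun p => (DirectSum.of (fun p : H1 S => Additive (kappa p.1)ˣ)
    (p.extend S)).comp (kappaUnitsMap S p)

theorem extendSum_of (p : H1 R) (u : Additive (kappa p.1)ˣ) :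
    extendSum S (DirectSum.of (fun p : H1 R => Additive (kappa p.1)ˣ) p u) =
      DirectSum.of (fun p : H1 S => Additive (kappa p.1)ˣ) (p.extend S) (kappaUnitsMap S p u) := by
  rw [extendSum, DirectSum.toAddMonoid_of]
  rfl

theorem extendSum_apply_extend (α : DirectSum (H1 R) (fun p => Additive (kappa p.1)ˣ)) (p : H1 R) :
    extendSum S α (p.extend S) = kappaUnitsMap S p (α p) := by
  induction α using DirectSum.induction_on with
  | zero => rw [map_zero, DirectSum.zero_apply, DirectSum.zero_apply, map_zero]
  | of p' u =>
    rw [extendSum_of]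
    by_cases h : p = p'
    · subst h
      rw [DirectSum.of_eq_same, DirectSum.of_eq_same]
    · rw [DirectSum.of_eq_of_ne _ _ _ ((H1.extend_injective S).ne h), DirectSum.of_eq_of_ne _ _ _ h,
        map_zero]
  | add α β hα hβ => rw [map_add, DirectSum.add_apply, hα, hβ, DirectSum.add_apply, map_add]

theorem extendSum_apply_of_ne (α : DirectSum (H1 R) (fun p => Additive (kappa p.1)ˣ)) {P : H1 S}
    (hP : ∀ p : H1 R, p.extend S ≠ P) : extendSum S α P = 0 := by
  induction α using DirectSum.induction_on with
  | zero => rw [map_zero, DirectSum.zero_apply]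
  | of p' u => rw [extendSum_of, DirectSum.of_eq_of_ne _ _ _ (hP p').symm]
  | add α β hα hβ => rw [map_add, DirectSum.add_apply, hα, hβ, add_zero]

theorem extendSum_injective : Function.Injective (extendSum (R := R) S) := fun α β h => by
  ext1 p
  apply kappaUnitsMap_injective S p
  rw [← extendSum_apply_extend, ← extendSum_apply_extend, h]

theorem mem_range_extendSum {α : DirectSum (H1 S) (fun p => Additive (kappa p.1)ˣ)}
    (h1 : ∀ P, (∀ p : H1 R, p.extend S ≠ P) → α P = 0)
    (h2 : ∀ p : H1 R, α (p.extend S) ∈ (kappaUnitsMap S p).range) :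
    α ∈ (extendSum (R := R) S).range := by
  classical
  rw [← DirectSum.sum_support_of α]
  refine sum_mem fun P _ => ?_
  by_cases hP : ∀ p : H1 R, p.extend S ≠ P
  · rw [h1 P hP, map_zero]
    exact zero_mem _
  · push Not at hP
    obtain ⟨p, rfl⟩ := hP
    obtain ⟨u, hu⟩ := h2 p
    exact ⟨DirectSum.of _ p u, by rw [extendSum_of, hu]⟩

end Extend

section Length

theorem localLength_eq_one {S : Type} [CommRing S] {Q I : Ideal S} [Q.IsPrime]
    (h : I.map (algebraMap S (Localization.AtPrime Q)) =
      IsLocalRing.maximalIdeal (Localization.AtPrime Q)) : localLength Q I = 1 := by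
  rw [localLength, Module.length_eq_one_iff, h, isSimpleModule_iff_isCoatom]
  exact Ideal.isMaximal_def.mp inferInstance

variable {R S : Type} [CommRing R] [CommRing S] [Algebra R S] [Module.Flat R S]

theorem localLength_map {q : Ideal R} [q.IsPrime] (Q : Ideal S) [Q.IsPrime]
    (hQ : q.map (algebraMap R S) = Q) (hq : Q.under R = q) (I : Ideal R) :
    localLength Q (I.map (algebraMap R S)) = localLength q I := by
  have : Q.LiesOver q := ⟨hq.symm⟩
  let := Localization.AtPrime.algebraOfLiesOver q Q
  let f := (Ideal.quotientEquivAlgOfEq (Localization.AtPrime Q)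
    (show (I.map (algebraMap R S)).map (algebraMap S (Localization.AtPrime Q)) =
      (I.map (algebraMap R (Localization.AtPrime q))).map
        (algebraMap (Localization.AtPrime q) (Localization.AtPrime Q)) by
      rw [Ideal.map_map, Ideal.map_map, ← IsScalarTower.algebraMap_eq,
        ← IsScalarTower.algebraMap_eq])).trans
    (Algebra.TensorProduct.quotIdealMapEquivTensorQuot (Localization.AtPrime Q)
      (I.map (algebraMap R (Localization.AtPrime q))))
  have h1 := localLength_eq_one (Q := Q) (I := Q) (Localization.AtPrime.map_eq_maximalIdeal)
  have hQ' : Q.map (algebraMap S (Localization.AtPrime Q)) =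
      q.map (algebraMap R (Localization.AtPrime Q)) := by
    rw [IsScalarTower.algebraMap_eq R S, ← Ideal.map_map, hQ]
  have h2 : (IsLocalRing.maximalIdeal (Localization.AtPrime q)).map
      (algebraMap (Localization.AtPrime q) (Localization.AtPrime Q)) =
      Q.map (algebraMap S (Localization.AtPrime Q)) := by
    rw [← Localization.AtPrime.map_eq_maximalIdeal, Ideal.map_map, ← IsScalarTower.algebraMap_eq,
      hQ']
  rw [localLength] at h1
  rw [localLength, f.toLinearEquiv.length_eq, IsLocalRing.length_baseChange, h2, h1, mul_one]
  rfl

end Length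

namespace GerstenData

open MilnorK2

theorem _root_.MilnorK2.rsymb_induction {R : Type} [CommRing R] [IsDomain R]
    [WfDvdMonoid R] {F : Type} [Field F] [Algebra R F] [IsFractionRing R F]
    {π : R} (hπ : Prime π) (D : AddSubgroup (MilnorK2 F))
    (hu : ∀ a b, ¬ π ∣ a → ¬ π ∣ b → rsymb F a b ∈ D)
    (hg : ∀ b, ¬ π ∣ b → rsymb F π b ∈ D) : D = ⊤ := by
  have hind : ∀ C : R → Prop, (∀ a b, a ≠ 0 → b ≠ 0 → C a → C b → C (a * b)) →
      (∀ a, ¬ π ∣ a → C a) → C π → ∀ a, a ≠ 0 → C a := by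
    intro C hmul hunit hgen a ha
    obtain ⟨n, b, hb, rfl⟩ := WfDvdMonoid.max_power_factor ha hπ.irreducible
    have hb0 : b ≠ 0 := by rintro rfl; exact hb (dvd_zero _)
    clear ha
    induction n with
    | zero => rw [pow_zero, one_mul]; exact hunit b hb
    | succ n ih =>
      rw [pow_succ', mul_assoc]
      exact hmul _ _ hπ.ne_zero (mul_ne_zero (pow_ne_zero _ hπ.ne_zero) hb0) hgen ih
  rw [eq_top_iff, ← closure_rsymb F (S := R), AddSubgroup.closure_le]
  rintro _ ⟨a, b, ha, hb, rfl⟩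
  refine hind (fun a => rsymb F a b ∈ D) (fun x y hx hy h1 h2 => ?_) (fun a ha => ?_) ?_ a ha
  · rw [rsymb_mul_left F hx hy]
    exact add_mem h1 h2
  · refine hind (fun b => rsymb F a b ∈ D) (fun x y hx hy h1 h2 => ?_) (fun b hb => hu a b ha hb)
      ?_ b hb
    · rw [rsymb_mul_right F _ hx hy]
      exact add_mem h1 h2
    · rw [rsymb_anticomm]
      exact neg_mem (hg a ha)
  · refine hind (fun b => rsymb F π b ∈ D) (fun x y hx hy h1 h2 => ?_) hg ?_ b hb
    · rw [rsymb_mul_right F _ hx hy]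
      exact add_mem h1 h2
    · rw [rsymb_self]
      exact hg _ fun h => hπ.not_isUnit (isUnit_of_dvd_unit h isUnit_one.neg)

theorem _root_.MilnorK2.map_rsymb {R S : Type} [CommRing R] [CommRing S] {F E : Type} [Field F]
    [Field E] [Algebra R F] [Algebra S E] (φ : R →+* S) (σ : F →+* E)
    (hσ : ∀ r, σ (algebraMap R F r) = algebraMap S E (φ r)) (a b : R) :
    map σ (rsymb F a b) = rsymb E (φ a) (φ b) := by
  rw [rsymb, map_symb, hσ, hσ, rsymb]

section Restrict

variable {R S : Type} [CommRing R] [CommRing S] [Algebra R S] [IsPolynomialExtension R S]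
  [IsDomain R] [IsDomain S] [UniqueFactorizationMonoid R]
  [IsNoetherianRing R] [IsNoetherianRing S] {F E : Type} [Field F] [Field E] [Algebra R F]
  [IsFractionRing R F] [Algebra S E] [DecidableEq (H1 R)] [DecidableEq (H1 S)]
  (G : GerstenData S E) (σ : F →+* E)
  (hσ : ∀ r, σ (algebraMap R F r) = algebraMap S E (algebraMap R S r))

include hσ

theorem tame_map_mem_range (η : MilnorK2 F) :
    G.tame (map σ η) ∈ (extendSum (R := R) S).range := by
  apply mem_range_extendSum
  · intro P hP
    have hP' : P.1.asIdeal.under R = ⊥ := by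
      by_contra h
      obtain ⟨p, hp⟩ := P.exists_extend_eq h
      exact hP p hp
    have hn : ∀ a : R, a ≠ 0 → algebraMap R S a ∉ P.1.asIdeal := fun a ha hmem => ha (by
      have : a ∈ P.1.asIdeal.under R := hmem
      rwa [hP'] at this)
    have hη : η ∈ AddSubgroup.closure
        {ξ : MilnorK2 F | ∃ a b : R, a ≠ 0 ∧ b ≠ 0 ∧ ξ = rsymb F a b} := by
      rw [closure_rsymb]; trivial
    induction hη using AddSubgroup.closure_induction with
    | mem x hx =>
      obtain ⟨a, b, ha, hb, rfl⟩ := hx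
      rw [map_rsymb _ σ hσ]
      exact G.tame_unit P _ _ (hn a ha) (hn b hb)
    | zero => rw [map_zero, map_zero, DirectSum.zero_apply]
    | add x y _ _ hx hy => rw [map_add, map_add, DirectSum.add_apply, hx, hy, add_zero]
    | neg x _ hx =>
      rw [map_neg, map_neg]
      exact neg_eq_zero.mpr hx
  · intro p
    have h := rsymb_induction (F := F) p.prime_gen
      ((kappaUnitsMap S p).range.comap
        (((DirectSum.component ℤ _ _ (p.extend S)).toAddMonoidHom.comp
        G.tame).comp (map σ))) ?_ ?_
    · have : η ∈ (⊤ : AddSubgroup (MilnorK2 F)) := trivial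
      rw [← h] at this
      exact this
    · intro a b ha hb
      rw [← H1.mem_iff_gen_dvd] at ha hb
      change G.tame (map σ (rsymb F a b)) (p.extend S) ∈ (kappaUnitsMap S p).range
      rw [map_rsymb _ σ hσ, G.tame_unit _ _ _ ((p.algebraMap_mem_extend_iff S).not.mpr ha)
        ((p.algebraMap_mem_extend_iff S).not.mpr hb)]
      exact zero_mem _
    · intro b hb
      rw [← H1.mem_iff_gen_dvd] at hb
      change G.tame (map σ (rsymb F p.gen b)) (p.extend S) ∈ (kappaUnitsMap S p).range
      have hb' := (p.algebraMap_mem_extend_iff S).not.mpr hb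
      rw [map_rsymb _ σ hσ, G.tame_gen _ _ ?_ _ hb']
      · exact ⟨_, kappaUnitsMap_residUnit S p b hb hb'⟩
      · rw [H1.extend_asIdeal, p.eq_span_gen, Ideal.map_span, Set.image_singleton]

/-- The tame symbol of the base. -/
noncomputable def restrictTame :
    MilnorK2 F →+ DirectSum (H1 R) (fun p => Additive (kappa p.1)ˣ) :=
  (AddMonoidHom.ofInjective (extendSum_injective S)).symm.toAddMonoidHom.comp
    ((G.tame.comp (map σ)).codRestrict _ (G.tame_map_mem_range σ hσ))

theorem extendSum_restrictTame (η : MilnorK2 F) :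
    extendSum S (G.restrictTame σ hσ η) = G.tame (map σ η) := by
  have := AddEquiv.apply_symm_apply (AddMonoidHom.ofInjective (extendSum_injective (R := R) S))
    ((G.tame.comp (map σ)).codRestrict _ (G.tame_map_mem_range σ hσ) η)
  exact congrArg Subtype.val this

theorem kappaUnitsMap_restrictTame (η : MilnorK2 F) (p : H1 R) :
    kappaUnitsMap S p (G.restrictTame σ hσ η p) = G.tame (map σ η) (p.extend S) := by
  rw [← extendSum_apply_extend, extendSum_restrictTame]

/-- The tame symbol and the divisor map of the base of a polynomial extension. -/
noncomputable def restrict : GerstenData R F where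
  tame := G.restrictTame σ hσ
  dv := (Finsupp.comapDomain.addMonoidHom (H2.extend_injective (R := R) S)).comp
    (G.dv.comp (extendSum S))
  tame_unit p a b ha hb := by
    apply kappaUnitsMap_injective S p
    rw [kappaUnitsMap_restrictTame, map_rsymb _ σ hσ, map_zero]
    exact G.tame_unit _ _ _ ((p.algebraMap_mem_extend_iff S).not.mpr ha)
      ((p.algebraMap_mem_extend_iff S).not.mpr hb)
  tame_gen p π hπ g hg := by
    have hg' := (p.algebraMap_mem_extend_iff S).not.mpr hg
    apply kappaUnitsMap_injective S p
    rw [kappaUnitsMap_restrictTame, map_rsymb _ σ hσ, kappaUnitsMap_residUnit S p g hg hg']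
    refine G.tame_gen _ _ ?_ _ hg'
    rw [H1.extend_asIdeal, hπ, Ideal.map_span, Set.image_singleton]
  dv_of p a ha q m hm := by
    have ha' := (p.algebraMap_mem_extend_iff S).not.mpr ha
    change G.dv (extendSum S _) (q.extend S) = m
    rw [extendSum_of, kappaUnitsMap_residUnit S p a ha ha']
    refine G.dv_of _ _ ha' _ m ?_
    have : (p.extend S).1.asIdeal ⊔ Ideal.span {algebraMap R S a} =
        (p.1.asIdeal ⊔ Ideal.span {a}).map (algebraMap R S) := by
      rw [Ideal.map_sup, Ideal.map_span, Set.image_singleton, H1.extend_asIdeal]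
    rw [this, localLength_map _ (q.extend_asIdeal S).symm (q.under_extend S), hm]

theorem dv_restrict (β : DirectSum (H1 R) (fun p => Additive (kappa p.1)ˣ)) (q : H2 R) :
    (G.restrict σ hσ).dv β q = G.dv (extendSum S β) (q.extend S) := rfl

end Restrict

end GerstenData

namespace GerstenData

open MilnorK2

section Support

variable {S : Type} [CommRing S] [IsDomain S] {E : Type} [Field E] [Algebra S E]
  [DecidableEq (H1 S)] (G : GerstenData S E)

theorem dv_of_eq_zero_of_not_le (P : H1 S) (u : Additive (kappa P.1)ˣ) (Q : H2 S)
    (h : ¬ P.1.asIdeal ≤ Q.1.asIdeal) :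
    G.dv (DirectSum.of (fun p : H1 S => Additive (kappa p.1)ˣ) P u) Q = 0 := by
  obtain ⟨a, b, ha, hb, hu⟩ := exists_residUnit_div P.1 u.toMul
  have : u = Additive.ofMul (residUnit P.1 a ha) - Additive.ofMul (residUnit P.1 b hb) :=
    congrArg Additive.ofMul hu
  rw [this, map_sub, map_sub, Finsupp.sub_apply,
    G.dv_residUnit_eq_zero P a ha Q fun hle => h (le_sup_left.trans hle),
    G.dv_residUnit_eq_zero P b hb Q fun hle => h (le_sup_left.trans hle), sub_zero]

theorem dv_eq_zero {α : DirectSum (H1 S) (fun p => Additive (kappa p.1)ˣ)} {Q : H2 S}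
    (h : ∀ P, P.1.asIdeal ≤ Q.1.asIdeal → α P = 0) : G.dv α Q = 0 := by
  classical
  rw [← DirectSum.sum_support_of α, map_sum, Finsupp.finsetSum_apply]
  refine Finset.sum_eq_zero fun P _ => ?_
  by_cases hP : P.1.asIdeal ≤ Q.1.asIdeal
  · rw [h P hP, map_zero, map_zero, Finsupp.zero_apply]
  · exact G.dv_of_eq_zero_of_not_le P _ Q hP

theorem dv_eq_of {α : DirectSum (H1 S) (fun p => Additive (kappa p.1)ˣ)} {Q : H2 S} (P₀ : H1 S)
    (h : ∀ P, P ≠ P₀ → P.1.asIdeal ≤ Q.1.asIdeal → α P = 0) :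
    G.dv α Q = G.dv (DirectSum.of (fun p : H1 S => Additive (kappa p.1)ˣ) P₀ (α P₀)) Q := by
  rw [← sub_eq_zero, ← Finsupp.sub_apply, ← map_sub]
  refine G.dv_eq_zero fun P hP => ?_
  rw [DirectSum.sub_apply]
  by_cases hne : P = P₀
  · subst hne
    rw [DirectSum.of_eq_same, sub_self]
  · rw [h P hne hP, DirectSum.of_eq_of_ne _ _ _ hne, sub_zero]

end Support

section Step

variable {R S : Type} [CommRing R] [CommRing S] [Algebra R S] [IsPolynomialExtension R S]
  [IsDomain R] [IsDomain S] [IsNoetherianRing R] [IsNoetherianRing S]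
  {E : Type} [Field E] [Algebra S E] [DecidableEq (H1 S)] (G : GerstenData S E)

omit [IsDomain S] [DecidableEq (H1 S)] in
theorem _root_.H1.eq_of_extend_le {p p' : H1 R} {Q : Ideal S} (hQ : Q.under R = p.1.asIdeal)
    (h : (p'.extend S).1.asIdeal ≤ Q) : p' = p :=
  H1.eq_of_le (by rw [← hQ]; exact (p'.extend_le_iff Q).mp h)

/-- An element of the residue field of an extended prime comes from the base unless it has a zero
or a pole at some prime which is not extended from the base. -/
theorem mem_range_kappaUnitsMap_or (p : H1 R) (u : Additive (kappa (p.extend S).1)ˣ) :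
    u ∈ (kappaUnitsMap S p).range ∨ ∃ Q : H2 S, Q.1.asIdeal.under R = p.1.asIdeal ∧
      G.dv (DirectSum.of (fun p : H1 S => Additive (kappa p.1)ˣ) (p.extend S) u) Q ≠ 0 := by
  obtain ⟨a, b, ha, hb, hu⟩ := exists_residUnit_div (p.extend S).1 u.toMul
  obtain ⟨deg, hdeg⟩ := exists_pseudoDegree_fiberMap S p.1.asIdeal
  have hmk : ∀ {c : S}, Ideal.Quotient.mk (p.1.asIdeal.map (algebraMap R S)) c ≠ 0 ↔
      c ∉ (p.extend S).1.asIdeal := fun {c} => Ideal.Quotient.eq_zero_iff_mem.not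
  obtain ⟨x, y, hx, hy, hxy, hcases⟩ := hdeg.exists_fraction (Ideal.Quotient.mk _ a)
    (Ideal.Quotient.mk _ b) (hmk.mpr ha) (hmk.mpr hb)
  obtain ⟨a', rfl⟩ := Ideal.Quotient.mk_surjective x
  obtain ⟨b', rfl⟩ := Ideal.Quotient.mk_surjective y
  rw [hmk] at hx hy
  have hprime := (p.extend S).1.isPrime
  have hu' : u = Additive.ofMul (residUnit (p.extend S).1 a' hx) -
      Additive.ofMul (residUnit (p.extend S).1 b' hy) := by
    have h1 : a * b' ∉ (p.extend S).1.asIdeal := fun h => (hprime.mem_or_mem h).elim ha hy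
    have h2 : a' * b ∉ (p.extend S).1.asIdeal := fun h => (hprime.mem_or_mem h).elim hx hb
    have h3 : residUnit _ _ h1 = residUnit _ _ h2 := by
      rw [residUnit_eq_iff, H1.extend_asIdeal, ← Ideal.Quotient.eq, map_mul, map_mul, hxy]
    rw [residUnit_mul _ _ _ h1 ha hy, residUnit_mul _ _ _ h2 hx hb] at h3
    have h4 : u.toMul = residUnit _ a' hx / residUnit _ b' hy := by
      rw [hu, div_eq_div_iff_mul_eq_mul, h3]
    exact congrArg Additive.ofMul h4
  rcases hcases with ⟨x, y, hx', hy'⟩ | ⟨Q, hQ, hQ0, hcases⟩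
  · refine Or.inl ?_
    have key : ∀ (x : R ⧸ p.1.asIdeal) (c : S) (hc : c ∉ (p.extend S).1.asIdeal),
        fiberMap S p.1.asIdeal x = Ideal.Quotient.mk _ c →
          Additive.ofMul (residUnit (p.extend S).1 c hc) ∈ (kappaUnitsMap S p).range := by
      intro x c hc hxc
      obtain ⟨r, rfl⟩ := Ideal.Quotient.mk_surjective x
      rw [fiberMap_mk] at hxc
      have hr' : algebraMap R S r ∉ (p.extend S).1.asIdeal := by
        rw [← hmk, hxc, hmk]
        exact hc
      have hr := (p.algebraMap_mem_extend_iff S).not.mp hr'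
      refine ⟨Additive.ofMul (residUnit p.1 r hr), ?_⟩
      rw [kappaUnitsMap_residUnit S p r hr hr']
      congr 1
      rw [residUnit_eq_iff, H1.extend_asIdeal, ← Ideal.Quotient.eq, hxc]
    rw [hu']
    exact sub_mem (key x a' hx hx') (key y b' hy hy')
  · refine Or.inr ?_
    have hunder : (Q.comap (Ideal.Quotient.mk (p.1.asIdeal.map (algebraMap R S)))).under R =
        p.1.asIdeal := by
      have : (Q.comap (Ideal.Quotient.mk (p.1.asIdeal.map (algebraMap R S)))).under R =
          (Q.comap (fiberMap S p.1.asIdeal)).comap (Ideal.Quotient.mk p.1.asIdeal) := rfl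
      rw [this, hQ0, ← RingHom.ker_eq_comap_bot, Ideal.mk_ker]
    obtain ⟨Q', hQ'⟩ := H2.exists_of_under_eq hunder fun h => by
      rcases hcases with ⟨h1, -⟩ | ⟨h1, -⟩
      · exact hx (by rw [H1.extend_asIdeal, ← h]; exact h1)
      · exact hy (by rw [H1.extend_asIdeal, ← h]; exact h1)
    refine ⟨Q', by rw [hQ', hunder], ?_⟩
    have hle : (p.extend S).1.asIdeal ≤ Q'.1.asIdeal := by
      rw [p.extend_le_iff, hQ', hunder]
    have hmem : ∀ {c : S}, (p.extend S).1.asIdeal ⊔ Ideal.span {c} ≤ Q'.1.asIdeal ↔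
        Ideal.Quotient.mk (p.1.asIdeal.map (algebraMap R S)) c ∈ Q := fun {c} => by
      rw [sup_le_iff, and_iff_right hle, Ideal.span_singleton_le_iff_mem, hQ']
      rfl
    rw [hu', map_sub, map_sub, Finsupp.sub_apply]
    rcases hcases with ⟨h1, h2⟩ | ⟨h1, h2⟩
    · rw [G.dv_residUnit_eq_zero _ b' hy Q' (hmem.not.mpr h2), sub_zero]
      exact (G.dv_residUnit_pos _ a' hx Q' (hmem.mpr h1)).ne'
    · rw [G.dv_residUnit_eq_zero _ a' hx Q' (hmem.not.mpr h2), zero_sub, neg_ne_zero]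
      exact (G.dv_residUnit_pos _ b' hy Q' (hmem.mpr h1)).ne'

variable [DecidableEq (H1 R)]

theorem dv_extendSum_of_under_eq (β : DirectSum (H1 R) (fun p => Additive (kappa p.1)ˣ)) {Q : H2 S}
    {p : H1 R} (hQ : Q.1.asIdeal.under R = p.1.asIdeal) : G.dv (extendSum S β) Q = 0 := by
  rw [G.dv_eq_of (p.extend S)]
  · rw [extendSum_apply_extend]
    obtain ⟨a, b, ha, hb, hu⟩ := exists_residUnit_div p.1 (β p).toMul
    have : β p = Additive.ofMul (residUnit p.1 a ha) - Additive.ofMul (residUnit p.1 b hb) :=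
      congrArg Additive.ofMul hu
    have key : ∀ (a : R) (ha : a ∉ p.1.asIdeal), G.dv (DirectSum.of
        (fun p : H1 S => Additive (kappa p.1)ˣ) (p.extend S) (kappaUnitsMap S p
          (Additive.ofMul (residUnit p.1 a ha)))) Q = 0 := by
      intro a ha
      have ha' := (p.algebraMap_mem_extend_iff S).not.mpr ha
      rw [kappaUnitsMap_residUnit S p a ha ha']
      refine G.dv_residUnit_eq_zero _ _ ha' Q fun hle => ha ?_
      rw [← hQ]
      exact hle (Ideal.mem_sup_right (Ideal.mem_span_singleton_self _))
    rw [this, map_sub, map_sub, map_sub, Finsupp.sub_apply, key a ha, key b hb, sub_zero]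
  · intro P hne hle
    refine extendSum_apply_of_ne S β fun p' hp' => hne ?_
    rw [← hp', H1.eq_of_extend_le (p' := p') hQ (by rw [hp']; exact hle)]

/-- A cycle on the fibres with vanishing divisor comes from the base. -/
theorem mem_range_extendSum_of_dv_eq_zero {α : DirectSum (H1 S) (fun p => Additive (kappa p.1)ˣ)}
    (h1 : ∀ P, (∀ p : H1 R, p.extend S ≠ P) → α P = 0) (h2 : G.dv α = 0) :
    α ∈ (extendSum (R := R) S).range := by
  refine mem_range_extendSum S h1 fun p => ?_
  refine (G.mem_range_kappaUnitsMap_or p (α (p.extend S))).resolve_right ?_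
  rintro ⟨Q, hQ, hne⟩
  apply hne
  rw [← G.dv_eq_of (p.extend S), h2, Finsupp.zero_apply]
  intro P hP hle
  refine h1 P fun p' hp' => hP ?_
  rw [← hp', H1.eq_of_extend_le (p' := p') hQ (by rw [hp']; exact hle)]

omit [DecidableEq (H1 R)] in
/-- A height-two prime lying over a height-one prime is the divisor of an element of the residue
field of the fibre, up to primes extended from the base. -/
theorem exists_dv_apply_eq {Q : H2 S} {p : H1 R} (hQ : Q.1.asIdeal.under R = p.1.asIdeal) :
    ∃ α, ∀ Q' : H2 S, (∀ q : H2 R, q.extend S ≠ Q') → G.dv α Q' = Finsupp.single Q 1 Q' := by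
  have hprime := Q.1.isPrime
  obtain ⟨deg, hdeg⟩ := exists_pseudoDegree_fiberMap S p.1.asIdeal
  have hle : (p.extend S).1.asIdeal ≤ Q.1.asIdeal := by rw [p.extend_le_iff, hQ]
  have hne : Q.1.asIdeal.map (Ideal.Quotient.mk (p.1.asIdeal.map (algebraMap R S))) ≠ ⊥ := by
    rw [Ne, Ideal.map_eq_bot_iff_le_ker, Ideal.mk_ker]
    intro h
    have h1 := Ideal.height_mono h
    rw [Q.height, ← H1.extend_asIdeal, H1.height] at h1
    norm_num at h1
  obtain ⟨g, hg, hg0, hgen⟩ := hdeg.exists_generator hne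
  obtain ⟨g, rfl⟩ := Ideal.Quotient.mk_surjective g
  have hgP : g ∉ (p.extend S).1.asIdeal := fun h => hg0 (Ideal.Quotient.eq_zero_iff_mem.mpr h)
  have hg := (Ideal.mem_quotient_iff_mem (I := p.1.asIdeal.map (algebraMap R S)) hle).mp hg
  have hmul : ∀ a ∈ Q.1.asIdeal, ∃ c ∉ p.1.asIdeal,
      algebraMap R S c * a ∈ (p.extend S).1.asIdeal ⊔ Ideal.span {g} := by
    intro a ha
    obtain ⟨c, hc, s, hs⟩ := hgen _ (Ideal.mem_map_of_mem _ ha)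
    obtain ⟨c, rfl⟩ := Ideal.Quotient.mk_surjective c
    obtain ⟨s, rfl⟩ := Ideal.Quotient.mk_surjective s
    refine ⟨c, fun h => hc (Ideal.Quotient.eq_zero_iff_mem.mpr h), ?_⟩
    rw [fiberMap_mk, ← map_mul, ← map_mul, Ideal.Quotient.eq] at hs
    rw [← sub_add_cancel (algebraMap R S c * a) (g * s)]
    exact add_mem (Ideal.mem_sup_left hs) (Ideal.mem_sup_right
      (Ideal.mul_mem_right _ _ (Ideal.mem_span_singleton_self g)))
  refine ⟨DirectSum.of _ (p.extend S) (Additive.ofMul (residUnit _ g hgP)), fun Q' hQ' => ?_⟩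
  by_cases hQQ : Q' = Q
  · subst hQQ
    rw [Finsupp.single_eq_same]
    refine G.dv_of _ g hgP Q' 1 (localLength_eq_one ?_)
    rw [← Localization.AtPrime.map_eq_maximalIdeal]
    refine le_antisymm (Ideal.map_mono (sup_le hle ((Ideal.span_singleton_le_iff_mem _).mpr hg))) ?_
    rw [Ideal.map_le_iff_le_comap]
    intro a ha
    obtain ⟨c, hc, hmem⟩ := hmul a ha
    have hc' : algebraMap R S c ∈ Q'.1.asIdeal.primeCompl := fun h => hc (by rw [← hQ]; exact h)
    have h1 := Ideal.mem_map_of_mem (algebraMap S (Localization.AtPrime Q'.1.asIdeal)) hmem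
    rw [map_mul] at h1
    exact (Ideal.unit_mul_mem_iff_mem _
      (IsLocalization.map_units (Localization.AtPrime Q'.1.asIdeal) ⟨_, hc'⟩)).mp h1
  · rw [Finsupp.single_eq_of_ne hQQ]
    refine G.dv_residUnit_eq_zero _ g hgP Q' fun hle' => hQQ ?_
    rcases H2.exists_extend_eq (R := R) Q' with ⟨q, hq⟩ | ⟨p', hp'⟩
    · exact (hQ' q hq).elim
    · obtain rfl := H1.eq_of_extend_le hp' (le_sup_left.trans hle')
      refine (H2.eq_of_le fun a ha => ?_).symm
      obtain ⟨c, hc, hmem⟩ := hmul a ha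
      exact (Q'.1.isPrime.mem_or_mem (hle' hmem)).resolve_left fun h => hc (by rw [← hp']; exact h)

variable [UniqueFactorizationMonoid R] [UniqueFactorizationMonoid S] [IsFractionRing S E]
  {F : Type} [Field F] [Algebra R F] [IsFractionRing R F] (σ : F →+* E)
  (hσ : ∀ r, σ (algebraMap R F r) = algebraMap S E (algebraMap R S r))

theorem exists_map_eq_of_tame_eq_zero {ξ : MilnorK2 E} (hξ : G.tame ξ = 0) :
    ∃ η, (G.restrict σ hσ).tame η = 0 ∧ map σ η = ξ := by
  obtain ⟨deg, hdeg⟩ := IsPolynomialExtension.exists_pseudoDegree R S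
  obtain ⟨η, rfl⟩ := exists_map_eq hdeg G σ hσ (ξ := ξ) fun P _ => by rw [hξ, DirectSum.zero_apply]
  refine ⟨η, extendSum_injective S ?_, rfl⟩
  rw [map_zero, ← hξ]
  exact G.extendSum_restrictTame σ hσ η

theorem exists_tame_eq_of_dv_eq_zero
    (ih : ∀ β, (G.restrict σ hσ).dv β = 0 → ∃ η, (G.restrict σ hσ).tame η = β)
    {α : DirectSum (H1 S) (fun p => Additive (kappa p.1)ˣ)} (hα : G.dv α = 0) :
    ∃ ξ, G.tame ξ = α := by
  obtain ⟨deg, hdeg⟩ := IsPolynomialExtension.exists_pseudoDegree R S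
  obtain ⟨ξ, hξ⟩ := exists_tame_eq hdeg G α
  have h0 : G.dv (α - G.tame ξ) = 0 := by rw [map_sub, hα, dv_tame, sub_zero]
  obtain ⟨β, hβ⟩ := G.mem_range_extendSum_of_dv_eq_zero (R := R) (α := α - G.tame ξ)
    (fun P hP => by
      have : 0 < deg P.gen := Nat.pos_of_ne_zero fun h =>
        let ⟨p, hp⟩ := H1.exists_extend_eq_of_deg hdeg P h
        hP p hp
      rw [DirectSum.sub_apply, hξ P this, sub_self]) h0
  obtain ⟨η, hη⟩ := ih β (by
    ext q
    rw [dv_restrict, hβ, h0]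
    rfl)
  refine ⟨map σ η + ξ, ?_⟩
  have : G.tame (map σ η) = extendSum S β := by
    rw [← hη]
    exact (G.extendSum_restrictTame σ hσ η).symm
  rw [map_add, this, hβ, sub_add_cancel]

omit [UniqueFactorizationMonoid S] [IsFractionRing S E] in
theorem dv_surjective_of_restrict (ih : Function.Surjective (G.restrict σ hσ).dv) :
    Function.Surjective G.dv := by
  have key : ∀ z : H2 S →₀ ℤ, (∀ Q : H2 S, (∀ q : H2 R, q.extend S ≠ Q) → z Q = 0) →
      z ∈ G.dv.range := by
    intro z hz
    obtain ⟨β, hβ⟩ := ih (z.comapDomain (H2.extend S) (H2.extend_injective S).injOn)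
    refine ⟨extendSum S β, ?_⟩
    ext Q
    rcases H2.exists_extend_eq (R := R) Q with ⟨q, rfl⟩ | ⟨p, hp⟩
    · rw [← G.dv_restrict σ hσ, hβ]
      rfl
    · rw [G.dv_extendSum_of_under_eq β hp, hz Q (H2.extend_ne_of_under_eq hp)]
  have single : ∀ Q : H2 S, Finsupp.single Q 1 ∈ G.dv.range := by
    intro Q
    rcases H2.exists_extend_eq (R := R) Q with ⟨q, rfl⟩ | ⟨p, hp⟩
    · exact key _ fun Q' hQ' => Finsupp.single_eq_of_ne fun h => hQ' q h.symm
    · obtain ⟨α, hα⟩ := G.exists_dv_apply_eq hp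
      have := key (Finsupp.single Q 1 - G.dv α) fun Q' hQ' => by
        rw [Finsupp.sub_apply, hα Q' hQ', sub_self]
      rw [← sub_add_cancel (Finsupp.single Q 1) (G.dv α)]
      exact add_mem this ⟨α, rfl⟩
  intro z
  change z ∈ G.dv.range
  induction z using Finsupp.induction_linear with
  | zero => exact zero_mem _
  | add x y hx hy => exact add_mem hx hy
  | single Q m =>
    rw [← mul_one m, ← smul_eq_mul, ← Finsupp.smul_single]
    exact zsmul_mem (single Q) m

end Step

end GerstenData

namespace MilnorK2

open nonZeroDivisors

variable {S k E : Type} [CommRing S] [IsDomain S] [Field k] [Field E] [Algebra S E]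
  [IsFractionRing S E]

/-- A multiplicative map `S → k` that is nonzero off zero and behaves like a leading coefficient
on sums induces a specialization map on `K₂ᴹ`, so any section of it is injective on `K₂ᴹ`. -/
theorem map_injective_of_specialization (l : S →* k) (hl0 : ∀ {s}, s ≠ 0 → l s ≠ 0)
    (hl : ∀ {a b : S}, a ≠ 0 → b ≠ 0 → a + b ≠ 0 →
      l (a + b) = l a ∨ l (a + b) = l b ∨ l a + l b = 0 ∨ l (a + b) = l a + l b)
    (τ : k →+* S) (hτ : ∀ c, l (τ c) = c) :
    Function.Injective (map ((algebraMap S E).comp τ)) := by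
  let L : E →* k := (IsLocalization.toLocalizationMap S⁰ E).lift (g := l)
    fun y => (hl0 (nonZeroDivisors.ne_zero y.2)).isUnit
  have hL : ∀ s, L (algebraMap S E s) = l s := fun s =>
    (IsLocalization.toLocalizationMap S⁰ E).lift_eq _ s
  let r : MilnorK2 E →+ MilnorK2 k := lift (fun f g => symbol (Units.map L f) (Units.map L g))
    (fun f g h => by rw [map_mul, symbol_mul_left])
    (fun f g h => by rw [map_mul, symbol_mul_right])
    (fun f g h => by
      classical
      obtain ⟨⟨s, hs⟩, hint⟩ := IsLocalization.exist_integer_multiples_of_finset S⁰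
        ({(f : E), (g : E)} : Finset E)
      obtain ⟨a, ha⟩ := hint f (by simp)
      obtain ⟨b, hb⟩ := hint g (by simp)
      simp only [Algebra.smul_def] at ha hb
      have hs0 := nonZeroDivisors.ne_zero hs
      have hsE : algebraMap S E s ≠ 0 := (map_ne_zero_iff _ (IsFractionRing.injective S E)).mpr hs0
      have hab : a + b = s := IsFractionRing.injective S E (by
        rw [map_add, ha, hb, ← mul_add, h, mul_one])
      have ha0 : a ≠ 0 := by
        rintro rfl
        rw [map_zero] at ha
        exact mul_ne_zero hsE f.ne_zero ha.symm
      have hb0 : b ≠ 0 := by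
        rintro rfl
        rw [map_zero] at hb
        exact mul_ne_zero hsE g.ne_zero hb.symm
      have hls := hl0 hs0
      have hfL : l s * L f = l a := by rw [← hL, ← hL, ha, map_mul]
      have hgL : l s * L g = l b := by rw [← hL, ← hL, hb, map_mul]
      have hl' := hl ha0 hb0 (hab ▸ hs0)
      rw [hab] at hl'
      rcases hl' with h | h | h | h
      · have : Units.map L f = 1 := by
          ext
          exact mul_left_cancel₀ hls (by
            rw [Units.val_one, mul_one]; exact hfL.trans h.symm)
        rw [this, symbol_one_left]
      · have : Units.map L g = 1 := by
          ext
          exact mul_left_cancel₀ hls (by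
            rw [Units.val_one, mul_one]; exact hgL.trans h.symm)
        rw [this, symbol_one_right]
      · have : Units.map L g = -Units.map L f := by
          ext
          refine mul_left_cancel₀ hls ?_
          rw [Units.val_neg, mul_neg]
          exact hgL.trans ((eq_neg_of_add_eq_zero_right h).trans (congrArg Neg.neg hfL.symm))
        rw [this, symbol_neg_self]
      · refine symbol_steinberg _ _ (mul_left_cancel₀ hls ?_)
        rw [mul_add, mul_one]
        exact (congrArg₂ (· + ·) hfL hgL).trans h.symm)
  have hr : r.comp (map ((algebraMap S E).comp τ)) = AddMonoidHom.id _ := hom_ext fun f g => by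
    have key : ∀ c : kˣ, Units.map L (Units.map ((algebraMap S E).comp τ).toMonoidHom c) = c :=
      fun c => by ext; exact (hL _).trans (hτ c)
    rw [AddMonoidHom.comp_apply, map_symbol]
    exact (lift_symbol _ _ _ _ _ _).trans (by rw [key, key]; rfl)
  exact Function.LeftInverse.injective fun x => DFunLike.congr_fun hr x

/-- The leading coefficient as a multiplicative map. -/
noncomputable def leadingCoeffHom {ι : Type} (m : MonomialOrder ι) (k : Type) [Field k] :
    MvPolynomial ι k →* k where
  toFun := m.leadingCoeff
  map_one' := m.leadingCoeff_one
  map_mul' _ _ := m.leadingCoeff_mul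

open MvPolynomial in
theorem map_algebraMap_injective (n : ℕ) {E : Type} [Field E] [Algebra (MvPolynomial (Fin n) k) E]
    [IsFractionRing (MvPolynomial (Fin n) k) E] :
    Function.Injective (map ((algebraMap (MvPolynomial (Fin n) k) E).comp C)) := by
  let m : MonomialOrder (Fin n) := MonomialOrder.lex
  refine map_injective_of_specialization (leadingCoeffHom m k)
    (fun h => m.leadingCoeff_ne_zero_iff.mpr h) (fun {a b} _ _ hab => ?_) C
    (fun c => m.leadingCoeff_C c)
  change m.leadingCoeff (a + b) = m.leadingCoeff a ∨ m.leadingCoeff (a + b) = m.leadingCoeff b ∨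
    m.leadingCoeff a + m.leadingCoeff b = 0 ∨
      m.leadingCoeff (a + b) = m.leadingCoeff a + m.leadingCoeff b
  rcases lt_trichotomy (m.toSyn (m.degree a)) (m.toSyn (m.degree b)) with h | h | h
  · exact Or.inr (Or.inl (by rw [add_comm, m.leadingCoeff_add_of_lt h]))
  · refine Or.inr (Or.inr (or_iff_not_imp_left.mpr fun hne => ?_))
    have hd := m.toSyn.injective h
    have hle : m.degree (a + b) = m.degree a := by
      refine m.toSyn.injective (le_antisymm (m.degree_add_le.trans (by rw [h, sup_idem])) ?_)
      refine m.le_degree (mem_support_iff.mpr ?_)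
      rw [coeff_add]
      nth_rw 2 [hd]
      exact hne
    rw [MonomialOrder.leadingCoeff, hle, coeff_add]
    nth_rw 2 [hd]
    rfl
  · exact Or.inl (m.leadingCoeff_add_of_lt h)

end MilnorK2

namespace MilnorK2

theorem map_surjective {F E : Type} [Field F] [Field E] {σ : F →+* E}
    (hσ : Function.Surjective σ) : Function.Surjective (map σ) := by
  have hu : Function.Surjective (Units.map σ.toMonoidHom) := fun e => by
    obtain ⟨f, hf⟩ := hσ e
    have hf0 : f ≠ 0 := by
      rintro rfl
      exact e.ne_zero (by rw [← hf, map_zero])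
    exact ⟨Units.mk0 f hf0, by ext; exact hf⟩
  rw [← AddMonoidHom.range_eq_top, eq_top_iff, ← closure_symbols, AddSubgroup.closure_le]
  rintro _ ⟨f, g, rfl⟩
  obtain ⟨f, rfl⟩ := hu f
  obtain ⟨g, rfl⟩ := hu g
  exact ⟨symbol f g, map_symbol σ f g⟩

end MilnorK2

theorem IsField.primeSpectrum_height_eq_zero {S : Type} [CommRing S] (h : IsField S)
    (p : PrimeSpectrum S) : Order.height p = 0 :=
  Order.height_eq_zero.mpr fun q _ a ha => by
    obtain rfl : a = 0 := by
      by_contra h0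
      obtain ⟨b, hb⟩ := h.mul_inv_cancel h0
      exact p.isPrime.ne_top ((Ideal.eq_top_iff_one _).mpr (hb ▸ Ideal.mul_mem_right b _ ha))
    exact zero_mem _

namespace GerstenData

open MilnorK2 MvPolynomial

/-- The Gersten complex of a polynomial ring over a field is exact. -/
theorem exact (k : Type) [Field k] (n : ℕ) {E : Type} [Field E]
    [Algebra (MvPolynomial (Fin n) k) E] [IsFractionRing (MvPolynomial (Fin n) k) E]
    [dec : DecidableEq (H1 (MvPolynomial (Fin n) k))] (G : GerstenData (MvPolynomial (Fin n) k) E) :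
    (∀ ξ, G.tame ξ = 0 →
      ξ ∈ (MilnorK2.map ((algebraMap (MvPolynomial (Fin n) k) E).comp C)).range) ∧
      (∀ α, G.dv α = 0 → ∃ ξ, G.tame ξ = α) ∧ Function.Surjective G.dv := by
  induction n generalizing E dec with
  | zero =>
    have hfield : IsField (MvPolynomial (Fin 0) k) :=
      (isEmptyRingEquiv k (Fin 0)).toMulEquiv.isField (Field.toIsField k)
    have h1 : IsEmpty (H1 (MvPolynomial (Fin 0) k)) := ⟨fun p => by
      have := p.2
      rw [hfield.primeSpectrum_height_eq_zero] at this
      norm_num at this⟩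
    have h2 : IsEmpty (H2 (MvPolynomial (Fin 0) k)) := ⟨fun p => by
      have := p.2
      rw [hfield.primeSpectrum_height_eq_zero] at this
      norm_num at this⟩
    refine ⟨fun ξ _ => MilnorK2.map_surjective ?_ ξ, fun α _ => ⟨0, ?_⟩, fun z => ⟨0, ?_⟩⟩
    · rw [RingHom.coe_comp]
      exact (IsFractionRing.surjective_iff_isField.mpr hfield).comp (C_surjective (Fin 0))
    · ext p
      exact (h1.false p).elim
    · ext q
      exact (h2.false q).elim
  | succ n ih =>
    classical
    let φ : MvPolynomial (Fin n) k →+* MvPolynomial (Fin (n + 1)) k :=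
      (finSuccEquiv k n).symm.toRingEquiv.toRingHom.comp Polynomial.C
    let : Algebra (MvPolynomial (Fin n) k) (MvPolynomial (Fin (n + 1)) k) := φ.toAlgebra
    have : IsPolynomialExtension (MvPolynomial (Fin n) k) (MvPolynomial (Fin (n + 1)) k) :=
      ⟨⟨AlgEquiv.ofRingEquiv (f := (finSuccEquiv k n).symm.toRingEquiv) fun _ => rfl⟩⟩
    have hφ : Function.Injective φ :=
      (finSuccEquiv k n).symm.injective.comp (Polynomial.C_injective)
    have hC : ∀ c, φ (C c) = C c := fun c => by
      change (finSuccEquiv k n).symm (Polynomial.C (C c)) = C c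
      rw [AlgEquiv.symm_apply_eq, finSuccEquiv_apply]
      simp
    have hE : Function.Injective ((algebraMap (MvPolynomial (Fin (n + 1)) k) E).comp φ) :=
      (IsFractionRing.injective _ E).comp hφ
    let σ : FractionRing (MvPolynomial (Fin n) k) →+* E := IsFractionRing.lift hE
    have hσ : ∀ r, σ (algebraMap _ _ r) = algebraMap (MvPolynomial (Fin (n + 1)) k) E
      (algebraMap _ _ r) := fun r => IsFractionRing.lift_algebraMap hE r
    obtain ⟨ih1, ih2, ih3⟩ := ih (G.restrict σ hσ)
    refine ⟨fun ξ hξ => ?_, fun α hα => G.exists_tame_eq_of_dv_eq_zero σ hσ ih2 hα,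
      G.dv_surjective_of_restrict σ hσ ih3⟩
    obtain ⟨η, hη, rfl⟩ := G.exists_map_eq_of_tame_eq_zero σ hσ hξ
    obtain ⟨ζ, rfl⟩ := ih1 η hη
    refine ⟨ζ, ?_⟩
    rw [← AddMonoidHom.comp_apply, ← map_comp]
    congr 2
    ext c
    exact ((hσ (C c)).trans (congrArg _ (hC c))).symm

end GerstenData

section Bridge

variable {S : Type} [CommRing S]

theorem lengthQuot_eq_localLength (Q P : Ideal S) [Q.IsPrime] (h : P ≤ Q)
    (hQ : (Q.map (Ideal.Quotient.mk P)).IsPrime) (a : S) :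
    lengthQuot _ hQ (Ideal.Quotient.mk P a) = localLength Q (P ⊔ Ideal.span {a}) := by
  have hcomap : Q = (Q.map (Ideal.Quotient.mk P)).comap (Ideal.Quotient.mk P) := by
    rw [Ideal.comap_map_of_surjective _ Ideal.Quotient.mk_surjective, ← RingHom.ker_eq_comap_bot,
      Ideal.mk_ker, sup_eq_left.mpr h]
  have hmem : ∀ b, b ∈ Q ↔ Ideal.Quotient.mk P b ∈ Q.map (Ideal.Quotient.mk P) := fun b => by
    conv_lhs => rw [hcomap]
    rfl
  let g := Localization.localRingHom Q (Q.map (Ideal.Quotient.mk P)) (Ideal.Quotient.mk P) hcomap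
  have hg : Function.Surjective g := fun y => by
    obtain ⟨b, ⟨s, hs⟩, rfl⟩ := IsLocalization.exists_mk'_eq
      (Q.map (Ideal.Quotient.mk P)).primeCompl y
    obtain ⟨b, rfl⟩ := Ideal.Quotient.mk_surjective b
    obtain ⟨s, rfl⟩ := Ideal.Quotient.mk_surjective s
    exact ⟨IsLocalization.mk' _ b (⟨s, fun h => hs ((hmem s).mp h)⟩ : Q.primeCompl),
      Localization.localRingHom_mk' _ _ _ _ _ _⟩
  have hspan : ∀ b, b ∈ P ⊔ Ideal.span {a} ↔
      Ideal.Quotient.mk P b ∈ Ideal.span {Ideal.Quotient.mk P a} := fun b => by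
    rw [← Set.image_singleton, ← Ideal.map_span, ← Ideal.mem_comap,
      Ideal.comap_map_of_surjective _ Ideal.Quotient.mk_surjective, ← RingHom.ker_eq_comap_bot,
      Ideal.mk_ker, sup_comm]
  have key : (P ⊔ Ideal.span {a}).map (algebraMap S (Localization.AtPrime Q)) =
      ((Ideal.span {Ideal.Quotient.mk P a}).map (algebraMap _
        (Localization.AtPrime (Q.map (Ideal.Quotient.mk P))))).comap g := by
    ext x
    obtain ⟨b, s, rfl⟩ := IsLocalization.exists_mk'_eq Q.primeCompl x
    rw [Ideal.mem_comap, Localization.localRingHom_mk', IsLocalization.mk'_mem_map_algebraMap_iff,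
      IsLocalization.mk'_mem_map_algebraMap_iff]
    constructor
    · rintro ⟨t, ht, h⟩
      exact ⟨Ideal.Quotient.mk P t, fun h => ht ((hmem t).mpr h), by rwa [← map_mul, ← hspan]⟩
    · rintro ⟨t, ht, h⟩
      obtain ⟨t, rfl⟩ := Ideal.Quotient.mk_surjective t
      exact ⟨t, fun h => ht ((hmem t).mp h), by rwa [hspan, map_mul]⟩
  rw [lengthQuot, localLength, ← Module.coe_length, Module.length_quotient, Module.length_quotient,
    key, Ideal.coheight_comap_of_surjective _ hg, Ideal.map_span, Set.image_singleton]

theorem symbPow_zero (p : PrimeSpectrum S) : symbPow p 0 = ⊤ := by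
  rw [symbPow, pow_zero, Ideal.one_eq_top, Ideal.comap_top]

theorem symbPow_one (p : PrimeSpectrum S) : symbPow p 1 = p.asIdeal := by
  rw [symbPow, pow_one, Localization.AtPrime.map_eq_maximalIdeal]
  exact IsLocalization.AtPrime.under_maximalIdeal _ p.asIdeal

theorem notMem_symbPow_two [IsDomain S] (p : PrimeSpectrum S) {π : S} (hπ0 : π ≠ 0)
    (hπ : p.asIdeal = Ideal.span {π}) : π ∉ symbPow p 2 := by
  have hmap : p.asIdeal.map (algebraMap S (Localization.AtPrime p.asIdeal)) =
      Ideal.span {algebraMap S (Localization.AtPrime p.asIdeal) π} :=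
    (congrArg (Ideal.map (algebraMap S (Localization.AtPrime p.asIdeal))) hπ).trans
      (by rw [Ideal.map_span, Set.image_singleton])
  rw [symbPow, Ideal.mem_comap, hmap, Ideal.span_singleton_pow, Ideal.mem_span_singleton]
  rintro ⟨c, hc⟩
  have h0 : algebraMap S (Localization.AtPrime p.asIdeal) π ≠ 0 :=
    (map_ne_zero_iff _ (IsLocalization.injective _ p.asIdeal.primeCompl_le_nonZeroDivisors)).mpr hπ0
  have h1 : algebraMap S (Localization.AtPrime p.asIdeal) π * c = 1 :=
    mul_left_cancel₀ h0 (by rw [mul_one, ← mul_assoc, ← pow_two, ← hc])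
  have h2 : π ∈ p.asIdeal := by rw [hπ]; exact Ideal.mem_span_singleton_self π
  rw [← IsLocalization.AtPrime.to_map_mem_maximal_iff (Localization.AtPrime p.asIdeal) p.asIdeal]
    at h2
  exact (IsLocalRing.maximalIdeal.isMaximal _).ne_top
    ((Ideal.eq_top_iff_one _).mpr (h1 ▸ Ideal.mul_mem_right c _ h2))

end Bridge

open MvPolynomial in
/-- Let `k` be an algebraically closed field of characteristic 0,
`F = k(x₁,…,xₙ)`, and `Z²(𝔸ⁿ)` the free abelian group on the height-two primes of
`k[x₁,…,xₙ]`.  Then the sequence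
`0 → K₂ᴹ(k) → K₂ᴹ(F) →(Tame) ⊕_p κ(p)* →(div) Z²(𝔸ⁿ) → 0`
is exact, where the first map `ι` is induced by the inclusion `k ⊆ F` (sending `{a,b}` to
`{a,b}`, pinned down by `hι`), `Tame` is the total tame symbol (with components the tame
symbols `tameAt p`, pinned down by `htameAt` via the discrete valuations `ν p`, themselves
pinned down by `hν_mul` and `hν_char`), and `dv` is the divisor map (pinned down by `hdv` via
the order functions `ord_q` of the one-dimensional local rings `(A_p)_q`, `A_p = k[x₁,…,xₙ]/p`,
with each height-one prime `q` of `A_p` identified with the corresponding height-two prime of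
`k[x₁,…,xₙ]`). -/
theorem gersten_sequence_exact
    (k : Type) [Field k] [IsAlgClosed k] [CharZero k] (n : ℕ)
    [DecidableEq (H1 (MvPolynomial (Fin n) k))]
    (ν : H1 (MvPolynomial (Fin n) k) → (FractionRing (MvPolynomial (Fin n) k))ˣ → ℤ)
    (hν_mul : ∀ p f g, ν p (f * g) = ν p f + ν p g)
    (hν_char : ∀ (p : H1 (MvPolynomial (Fin n) k)) (a : MvPolynomial (Fin n) k)
      (u : (FractionRing (MvPolynomial (Fin n) k))ˣ),
      (u : FractionRing (MvPolynomial (Fin n) k)) = algebraMap _ _ a →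
      ∀ m : ℕ, (ν p u = m ↔ a ∈ symbPow p.1 m ∧ a ∉ symbPow p.1 (m + 1)))
    (tameAt : ∀ p : H1 (MvPolynomial (Fin n) k),
      MilnorK2 (FractionRing (MvPolynomial (Fin n) k)) →+ Additive (kappa p.1)ˣ)
    (htameAt : ∀ (p : H1 (MvPolynomial (Fin n) k))
      (f g : (FractionRing (MvPolynomial (Fin n) k))ˣ) (a s : MvPolynomial (Fin n) k),
      a ∉ p.1.asIdeal → s ∉ p.1.asIdeal →
      ((-1 : FractionRing (MvPolynomial (Fin n) k)) ^ (ν p f * ν p g)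
          * (g : FractionRing (MvPolynomial (Fin n) k)) ^ (ν p f)
          * (f : FractionRing (MvPolynomial (Fin n) k)) ^ (-(ν p g))
        = algebraMap _ _ a / algebraMap _ _ s) →
      ∀ u : (kappa p.1)ˣ, (u : kappa p.1) * resid p.1 s = resid p.1 a →
        tameAt p (MilnorK2.symbol f g) = Additive.ofMul u)
    (Tame : MilnorK2 (FractionRing (MvPolynomial (Fin n) k)) →+
      DirectSum (H1 (MvPolynomial (Fin n) k)) (fun p => Additive (kappa p.1)ˣ))
    (hTame : ∀ ξ p, Tame ξ p = tameAt p ξ)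
    (ι : MilnorK2 k →+ MilnorK2 (FractionRing (MvPolynomial (Fin n) k)))
    (hι : ∀ a b : kˣ, ι (MilnorK2.symbol a b) =
      MilnorK2.symbol
        (Units.map (algebraMap k (FractionRing (MvPolynomial (Fin n) k))).toMonoidHom a)
        (Units.map (algebraMap k (FractionRing (MvPolynomial (Fin n) k))).toMonoidHom b))
    (dv : DirectSum (H1 (MvPolynomial (Fin n) k)) (fun p => Additive (kappa p.1)ˣ)
      →+ (H2 (MvPolynomial (Fin n) k) →₀ ℤ))
    (hdv : ∀ (p : H1 (MvPolynomial (Fin n) k)) (a b : MvPolynomial (Fin n) k),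
      a ∉ p.1.asIdeal → b ∉ p.1.asIdeal →
      ∀ u : (kappa p.1)ˣ, (u : kappa p.1) * resid p.1 b = resid p.1 a →
      ∀ q : H2 (MvPolynomial (Fin n) k),
        (¬ p.1.asIdeal ≤ q.1.asIdeal →
          dv (DirectSum.of _ p (Additive.ofMul u)) q = 0) ∧
        (p.1.asIdeal ≤ q.1.asIdeal →
          ∀ hQ : (Ideal.map (Ideal.Quotient.mk p.1.asIdeal) q.1.asIdeal).IsPrime,
          ∀ ma mb : ℕ,
            lengthQuot _ hQ (Ideal.Quotient.mk p.1.asIdeal a) = (ma : ℕ∞) →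
            lengthQuot _ hQ (Ideal.Quotient.mk p.1.asIdeal b) = (mb : ℕ∞) →
            dv (DirectSum.of _ p (Additive.ofMul u)) q = (ma : ℤ) - (mb : ℤ))) :
    Function.Injective ι ∧
    AddMonoidHom.range ι = AddMonoidHom.ker Tame ∧
    AddMonoidHom.range Tame = AddMonoidHom.ker dv ∧
    Function.Surjective dv := by
  have hgen : ∀ (p : H1 (MvPolynomial (Fin n) k)) (π : MvPolynomial (Fin n) k),
      p.1.asIdeal = Ideal.span {π} → π ≠ 0 := by
    rintro p π h rfl
    exact p.ne_bot (h.trans (Ideal.span_singleton_eq_bot.mpr rfl))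
  have hne : ∀ (p : H1 (MvPolynomial (Fin n) k)) {a : MvPolynomial (Fin n) k},
      a ∉ p.1.asIdeal → algebraMap _ (FractionRing (MvPolynomial (Fin n) k)) a ≠ 0 :=
    fun p a ha => MilnorK2.algebraMap_ne_zero _ fun h => ha (h ▸ p.1.asIdeal.zero_mem)
  have hν_unit : ∀ (p : H1 (MvPolynomial (Fin n) k)) (a : MvPolynomial (Fin n) k)
      (ha : a ∉ p.1.asIdeal), ν p (Units.mk0 _ (hne p ha)) = 0 := fun p a ha =>
    (hν_char p a _ rfl 0).mpr ⟨by simp [symbPow_zero], by simpa [symbPow_one] using ha⟩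
  have hν_gen : ∀ (p : H1 (MvPolynomial (Fin n) k)) (π : MvPolynomial (Fin n) k)
      (h : p.1.asIdeal = Ideal.span {π}),
      ν p (Units.mk0 _ (MilnorK2.algebraMap_ne_zero
        (FractionRing (MvPolynomial (Fin n) k)) (hgen p π h))) = 1 := fun p π h =>
    (hν_char p π _ rfl 1).mpr
      ⟨by rw [symbPow_one, h]; exact Ideal.mem_span_singleton_self π,
        notMem_symbPow_two p.1 (hgen p π h) h⟩
  have h1 : ∀ p : PrimeSpectrum (MvPolynomial (Fin n) k),
      (1 : MvPolynomial (Fin n) k) ∉ p.asIdeal := fun p => (Ideal.ne_top_iff_one _).mp p.isPrime.ne_top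
  have hres : ∀ p : PrimeSpectrum (MvPolynomial (Fin n) k), resid p 1 = 1 := fun p => by
    simp [resid]
  let G : GerstenData (MvPolynomial (Fin n) k) (FractionRing (MvPolynomial (Fin n) k)) :=
    { tame := Tame
      dv := dv
      tame_unit := fun p a b ha hb => by
        have := htameAt p (Units.mk0 _ (hne p ha)) (Units.mk0 _ (hne p hb)) 1 1 (h1 _) (h1 _)
          (by simp [hν_unit p a ha, hν_unit p b hb]) 1 (by simp)
        rw [hTame, ← ofMul_one, ← this, ← MilnorK2.symb_coe]
        rfl
      tame_gen := fun p π h g hg => by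
        rw [hTame, ← htameAt p (Units.mk0 _ (MilnorK2.algebraMap_ne_zero _ (hgen p π h)))
          (Units.mk0 _ (hne p hg)) g 1 hg (h1 _) (by simp [hν_gen p π h, hν_unit p g hg])
          (residUnit p.1 g hg) (by rw [hres, mul_one, residUnit_val]), ← MilnorK2.symb_coe]
        rfl
      dv_of := fun p a ha q m hm => by
        have hdvq := hdv p a 1 ha (h1 _) (residUnit p.1 a ha)
          (by rw [hres, mul_one, residUnit_val]) q
        by_cases h : p.1.asIdeal ≤ q.1.asIdeal
        · have hQ : (Ideal.map (Ideal.Quotient.mk p.1.asIdeal) q.1.asIdeal).IsPrime :=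
            Ideal.map_isPrime_of_surjective Ideal.Quotient.mk_surjective
              (by rwa [Ideal.mk_ker])
          have h2 := hdvq.2 h hQ m 0 (by rw [lengthQuot_eq_localLength _ _ h, hm]) (by
            rw [lengthQuot_eq_localLength _ _ h, localLength_eq_zero]
            · rfl
            · exact fun hle => h1 q.1 (hle (Ideal.mem_sup_right (Ideal.mem_span_singleton_self 1))))
          rw [h2, Nat.cast_zero, sub_zero]
        · have hm0 : m = 0 := by
            rw [localLength_eq_zero _ _ fun hle => h (le_sup_left.trans hle)] at hm
            exact_mod_cast hm.symm
          rw [hdvq.1 h, hm0, Nat.cast_zero] }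
  have hι_eq : ι = MilnorK2.map
      ((algebraMap (MvPolynomial (Fin n) k) (FractionRing (MvPolynomial (Fin n) k))).comp C) :=
    MilnorK2.hom_ext fun a b => by
      rw [hι, MilnorK2.map_symbol]
      rfl
  obtain ⟨hker, hexact, hsurj⟩ := G.exact k n
  refine ⟨hι_eq ▸ MilnorK2.map_algebraMap_injective n, le_antisymm ?_ fun ξ hξ => ?_,
    le_antisymm ?_ fun α hα => hexact α hα, hsurj⟩
  · have hTι : Tame.comp ι = 0 := MilnorK2.hom_ext fun a b => by
      rw [AddMonoidHom.comp_apply, hι_eq, MilnorK2.map_symbol, ← MilnorK2.symb_coe]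
      exact G.tame_rsymb_units (a.isUnit.map C) (b.isUnit.map C)
    rintro _ ⟨ξ, rfl⟩
    exact DFunLike.congr_fun hTι ξ
  · rw [hι_eq]
    exact hker ξ hξ
  · rintro _ ⟨ξ, rfl⟩
    exact G.dv_tame ξ
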